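/- arXiv:math/0610294 — 5 statements merged into one kernel-verified Lean document; each statement's English description precedes it below -/
import Mathlib

section
/- Let p be an odd prime, n ≥ 4, and let G be a p-group of order p^n of maximal class (nilpotency class n−1). Then Aut(G) has a normal Sylow p-subgroup P with a complement H, and H is isomorphic to a subgroup of C_{p−1} × C_{p−1}. -/
namespace MaxClassAux

open scoped commutatorElement

/-- action on a section -/
theorem exists_section_char {G : Type*} [Group G] [Finite G] (p : ℕ) [Fact p.Prime]
    (M N : Subgroup G) [M.Characteristic] [N.Characteristic] (hr : M.relIndex N = p) :
    ∃ χ : MulAut G →* Multiplicative (ZMod (p - 1)), ∀ α, χ α = 1 → ∀ x ∈ N, x⁻¹ * α x ∈ M := by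
  have hN : ∀ (α : MulAut G) (x : G), x ∈ N → α x ∈ N := fun α x hx =>
    (Subgroup.characteristic_iff_le_comap.1 inferInstance α) hx
  have hM : ∀ (α : MulAut G) (x : G), x ∈ M → α x ∈ M := fun α x hx =>
    (Subgroup.characteristic_iff_le_comap.1 inferInstance α) hx
  let Q := N ⧸ M.subgroupOf N
  let r : MulAut G → (N →* N) := fun α =>
    { toFun := fun x => ⟨α x, hN α x x.2⟩
      map_one' := by ext; simp
      map_mul' := by intros; ext; simp }
  let e : MulAut G → (Q →* Q) := fun α => QuotientGroup.map _ _ (r α) (by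
    intro x hx
    exact hM α x hx)
  have he : ∀ α β x, e (α * β) x = e α (e β x) := by
    intro α β x
    induction x using QuotientGroup.induction_on
    rfl
  have he1 : ∀ x, e 1 x = x := by
    intro x
    induction x using QuotientGroup.induction_on
    rfl
  let φ : MulAut G →* MulAut Q :=
    { toFun := fun α =>
        { toFun := e α
          invFun := e α⁻¹
          left_inv := fun x => by rw [← he, inv_mul_cancel, he1]
          right_inv := fun x => by rw [← he, mul_inv_cancel, he1]
          map_mul' := map_mul _ }
      map_one' := by ext x; exact he1 x
      map_mul' := fun α β => by ext x; exact he α β x }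
  have hcQ : Nat.card Q = p := hr
  have : IsCyclic Q := isCyclic_of_prime_card hcQ
  have hc1 : Nat.card (MulAut Q) = Nat.card (Multiplicative (ZMod (p - 1))) := by
    rw [IsCyclic.card_mulAut, hcQ, Nat.totient_prime Fact.out, Nat.card_congr Multiplicative.toAdd, Nat.card_zmod]
  have e0 := IsCyclic.mulAutMulEquiv Q
  rw [hcQ] at e0
  have : IsCyclic (MulAut Q) := isCyclic_of_surjective e0.symm e0.symm.surjective
  let f : MulAut Q ≃* Multiplicative (ZMod (p - 1)) := mulEquivOfCyclicCardEq hc1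
  refine ⟨f.toMonoidHom.comp φ, fun α hα x hx => ?_⟩
  have h1 : φ α = 1 := by
    apply f.injective
    rw [map_one]; exact hα
  have h2 : φ α (QuotientGroup.mk ⟨x, hx⟩) = QuotientGroup.mk ⟨x, hx⟩ := by rw [h1]; rfl
  have h3 := QuotientGroup.eq.1 h2.symm
  exact h3

theorem coprime_step {G : Type*} [Group G] {p n q : ℕ} (hcard : ∀ x : G, x ^ p ^ n = 1)
    (hq : Nat.Coprime q p) (M N : Subgroup G) [M.Characteristic] (α : MulAut G) (hα : α ^ q = 1)
    (hN : ∀ y ∈ N, y⁻¹ * α y ∈ M) (x : G) (hx : x⁻¹ * α x ∈ N) : x⁻¹ * α x ∈ M := by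
  have hM : ∀ (x : G), x ∈ M → α x ∈ M := fun x hx =>
    (Subgroup.characteristic_iff_le_comap.1 inferInstance α) hx
  set c := x⁻¹ * α x with hc
  let π := QuotientGroup.mk' M
  have hπ : ∀ u v : G, u⁻¹ * v ∈ M → π u = π v := fun u v h => QuotientGroup.eq.2 h
  have hcon : ∀ u v : G, π u = π v → π (α u) = π (α v) := by
    intro u v h
    apply hπ
    have := hM _ (QuotientGroup.eq.1 h)
    simpa using this
  have hk : ∀ k : ℕ, π ((α ^ k) x) = π (x * c ^ k) := by
    intro k
    induction k with
    | zero => simp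
    | succ k ih =>
      rw [pow_succ', MulAut.mul_apply, hcon _ _ ih]
      have h1 : π c = π (α c) := hπ _ _ (hN c hx)
      have h2 : α x = x * c := by simp [hc]
      clear_value c
      rw [map_mul, map_pow, h2, map_mul, map_pow, ← h1, map_mul, map_mul, map_pow, mul_assoc,
        ← pow_succ']
  have h1 := hk q
  rw [hα] at h1
  have h2 : (π c) ^ q = 1 := by simpa using h1
  have h3 : (π c) ^ (p ^ n) = 1 := by rw [← map_pow, hcard, map_one]
  have h4 : π c = 1 := by
    rw [← orderOf_eq_one_iff]
    exact Nat.eq_one_of_dvd_coprimes (Nat.Coprime.pow_right n hq) (orderOf_dvd_of_pow_eq_one h2)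
      (orderOf_dvd_of_pow_eq_one h3)
  exact (QuotientGroup.eq_one_iff c).1 h4

theorem triv_of_triv_ab {G : Type*} [Group G] {p n q : ℕ} (hcard : ∀ x : G, x ^ p ^ n = 1)
    (hq : Nat.Coprime q p) (α : MulAut G) (hα : α ^ q = 1)
    (h : ∀ x, x⁻¹ * α x ∈ (⊤ : Subgroup G).lowerCentralSeries 1) (i : ℕ) :
    ∀ x, x⁻¹ * α x ∈ (⊤ : Subgroup G).lowerCentralSeries (i + 1) := by
  induction i with
  | zero => exact h
  | succ i ih =>
    intro x
    refine coprime_step hcard hq _ ((⊤ : Subgroup G).lowerCentralSeries (i + 1)) α hα ?_ x (ih x)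
    intro y hy
    set M := (⊤ : Subgroup G).lowerCentralSeries (i + 1 + 1) with hMdef
    let π := QuotientGroup.mk' M
    have hcent : ∀ c ∈ (⊤ : Subgroup G).lowerCentralSeries (i + 1), ∀ g : G,
        π c * π g = π g * π c := by
      intro c hc g
      have : ⁅c, g⁆ ∈ M := Subgroup.commutator_mem_commutator hc trivial
      have := (QuotientGroup.eq_one_iff _).2 this
      rw [← commutatorElement_eq_one_iff_mul_comm, ← map_commutatorElement]
      exact this
    have key : ∀ a g : G, π (α ⁅a, g⁆) = π ⁅a, g⁆ := by
      intro a g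
      obtain ⟨c, hc⟩ : ∃ c, c = a⁻¹ * α a := ⟨_, rfl⟩
      obtain ⟨d, hd⟩ : ∃ d, d = g⁻¹ * α g := ⟨_, rfl⟩
      have h1 : α a = a * c := by simp [hc]
      have h2 : α g = g * d := by simp [hd]
      have hcc := hcent c (hc ▸ ih a)
      have hdc := hcent d (hd ▸ ih g)
      rw [map_commutatorElement, h1, h2]
      simp only [commutatorElement_def, map_mul, map_inv, mul_inv_rev]
      have e1 := hcc g
      have e2 := hcc d
      have e3 := hdc a
      have e4 := hdc g
      generalize π a = A at *
      generalize π g = B at *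
      generalize π c = C at *
      generalize π d = D at *
      calc A * C * (B * D) * (C⁻¹ * A⁻¹) * (D⁻¹ * B⁻¹)
          = A * (C * B) * D * C⁻¹ * A⁻¹ * D⁻¹ * B⁻¹ := by group
        _ = A * B * (C * D) * C⁻¹ * A⁻¹ * D⁻¹ * B⁻¹ := by rw [e1]; group
        _ = A * B * A⁻¹ * (A * D) * A⁻¹ * D⁻¹ * B⁻¹ := by rw [e2]; group
        _ = A * B * A⁻¹ * B⁻¹ := by rw [← e3]; group
    have hle : (⊤ : Subgroup G).lowerCentralSeries (i + 1) ≤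
        MonoidHom.eqLocus (π.comp α.toMonoidHom) π := by
      rw [Subgroup.lowerCentralSeries_succ, Subgroup.commutator_le]
      intro a _ g _
      exact key a g
    have := hle hy
    exact QuotientGroup.eq.1 (Eq.symm this)

theorem exists_char_max {G : Type*} [Group G] [Finite G] (p : ℕ) [Fact p.Prime]
    (A B C : Subgroup G) [A.Characteristic] [B.Characteristic] [C.Characteristic]
    (hB : ⁅A, (⊤ : Subgroup G)⁆ = B) (hC : ⁅B, (⊤ : Subgroup G)⁆ = C)
    (hAB : Nat.card A = p * Nat.card B) (hBC : Nat.card B = p * Nat.card C) :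
    ∃ P : Subgroup G, P.Characteristic ∧ P.index = p ∧ commutator G ≤ P := by
  have hp : p.Prime := Fact.out
  have hBA : B ≤ A := hB ▸ Subgroup.commutator_le_left _ _
  have hCB : C ≤ B := hC ▸ Subgroup.commutator_le_left _ _
  let π := QuotientGroup.mk' C
  have hπ1 : ∀ x, π x = 1 ↔ x ∈ C := fun x => QuotientGroup.eq_one_iff x
  have hcent : ∀ c ∈ B, ∀ g : G, π c * π g = π g * π c := by
    intro c hc g
    have : ⁅c, g⁆ ∈ C := hC ▸ Subgroup.commutator_mem_commutator hc trivial
    rw [← commutatorElement_eq_one_iff_mul_comm, ← map_commutatorElement]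
    exact (hπ1 _).2 this
  have hposB : 0 < Nat.card B := Nat.card_pos
  have hposC : 0 < Nat.card C := Nat.card_pos
  obtain ⟨x₀, hx₀A, hx₀B⟩ : ∃ x ∈ A, x ∉ B := by
    by_contra! hcon
    have : A = B := le_antisymm hcon hBA
    rw [this] at hAB
    nlinarith [hp.two_le]
  have hmem : ∀ g, ⁅x₀, g⁆ ∈ B := fun g => hB ▸ Subgroup.commutator_mem_commutator hx₀A trivial
  let ψ : G →* G ⧸ C :=
    { toFun := fun g => π ⁅x₀, g⁆
      map_one' := by simp
      map_mul' := fun g h => by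
        have e1 := hcent _ (hmem h) g
        have : ⁅x₀, g * h⁆ = ⁅x₀, g⁆ * (g * ⁅x₀, h⁆ * g⁻¹) := by
          simp only [commutatorElement_def]; group
        rw [this, map_mul, map_mul, map_mul, ← e1, mul_assoc, ← map_mul, mul_inv_cancel,
          map_one, mul_one] }
  have hψ : ∀ g, ψ g = π ⁅x₀, g⁆ := fun g => rfl
  have hker : ∀ g, g ∈ ψ.ker ↔ ∀ x ∈ A, ⁅x, g⁆ ∈ C := by
    intro g
    rw [MonoidHom.mem_ker, hψ, hπ1]
    refine ⟨fun h => ?_, fun h => h _ hx₀A⟩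
    let S := (Subgroup.centralizer {π g}).comap π
    have hS : ∀ x, x ∈ S ↔ π x * π g = π g * π x := by
      intro x
      simp only [S, Subgroup.mem_comap]
      rw [Subgroup.mem_centralizer_singleton_iff]
    have hBS : B ≤ A ⊓ S := fun x hx => ⟨hBA hx, (hS x).2 (hcent x hx g)⟩
    have hxS : x₀ ∈ S := by
      rw [hS, ← commutatorElement_eq_one_iff_mul_comm, ← map_commutatorElement]
      exact (hπ1 _).2 h
    have hAS : A ⊓ S = A := by
      have d1 := Subgroup.card_dvd_of_le hBS
      have d2 := Subgroup.card_dvd_of_le (inf_le_left : A ⊓ S ≤ A)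
      obtain ⟨k, hk⟩ := d1
      rw [hAB, hk, mul_comm p] at d2
      have d3 := Nat.dvd_of_mul_dvd_mul_left hposB d2
      rcases (Nat.dvd_prime hp).1 d3 with h1 | h1
      · exfalso
        rw [h1, mul_one] at hk
        have : B = A ⊓ S := Subgroup.eq_of_le_of_card_ge hBS hk.le
        exact hx₀B (this ▸ ⟨hx₀A, hxS⟩)
      · apply Subgroup.eq_of_le_of_card_ge inf_le_left
        rw [hAB, hk, h1, mul_comm]
    intro x hx
    have : x ∈ A ⊓ S := by rw [hAS]; exact hx
    have := (hS x).1 this.2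
    rw [← commutatorElement_eq_one_iff_mul_comm, ← map_commutatorElement] at this
    exact (hπ1 _).1 this
  refine ⟨ψ.ker, ?_, ?_, ?_⟩
  · rw [Subgroup.characteristic_iff_le_comap]
    intro α g hg
    have hg := (hker g).1 hg
    refine (hker _).2 fun x hx => ?_
    have h1 : α.symm x ∈ A := (Subgroup.characteristic_iff_le_comap.1 inferInstance α.symm) hx
    have h2 : α ⁅α.symm x, g⁆ ∈ C :=
      (Subgroup.characteristic_iff_le_comap.1 inferInstance α) (hg _ h1)
    simpa [map_commutatorElement] using h2
  · rw [Subgroup.index_ker]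
    have h1 : ψ.range ≤ B.map π := by
      rintro _ ⟨g, rfl⟩
      exact ⟨_, hmem g, rfl⟩
    have h2 := Subgroup.card_dvd_of_le h1
    have h3 : Nat.card (B.map π) = p := by
      have h4 := Subgroup.card_mul_index (C.subgroupOf B)
      have h5 : (C.subgroupOf B).index = Nat.card (B.map π) := by
        have := Subgroup.relIndex_ker B π
        rw [QuotientGroup.ker_mk'] at this
        exact this
      have h6 : Nat.card (C.subgroupOf B) = Nat.card C :=
        Nat.card_congr (Subgroup.subgroupOfEquivOfLe hCB).toEquiv
      rw [h5, h6, hBC, mul_comm p] at h4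
      exact Nat.eq_of_mul_eq_mul_left hposC h4
    rw [h3] at h2
    rcases (Nat.dvd_prime hp).1 h2 with h | h
    · exfalso
      rw [← Subgroup.index_ker, Subgroup.index_eq_one] at h
      have : B ≤ C := by
        rw [← hB, Subgroup.commutator_le]
        intro x hx g _
        exact (hker g).1 (h ▸ trivial) x hx
      have : B = C := le_antisymm this hCB
      rw [this] at hBC
      nlinarith [hp.two_le]
    · exact h
  · rw [commutator_def, Subgroup.commutator_le]
    intro g _ h _
    rw [MonoidHom.mem_ker, map_commutatorElement, commutatorElement_eq_one_iff_mul_comm]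
    exact hcent _ (hmem g) _

theorem lcs_card {p : ℕ} [Fact p.Prime] {n : ℕ} (hn : 4 ≤ n)
    {G : Type*} [Group G] [Finite G] [Group.IsNilpotent G]
    (hcard : Nat.card G = p ^ n) (hclass : Group.nilpotencyClass G = n - 1) :
    ∀ k, 1 ≤ k → k ≤ n - 1 →
      Nat.card ((⊤ : Subgroup G).lowerCentralSeries k) = p ^ (n - 1 - k) := by
  have hp : p.Prime := Fact.out
  let L := (⊤ : Subgroup G).lowerCentralSeries
  have hL : ∀ k, L (k + 1) = ⁅L k, (⊤ : Subgroup G)⁆ := fun k => rfl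
  have hex : ∀ k, ∃ e, Nat.card (L k) = p ^ e := by
    intro k
    have := Subgroup.card_subgroup_dvd_card (L k)
    rw [hcard, Nat.dvd_prime_pow hp] at this
    obtain ⟨e, _, he⟩ := this
    exact ⟨e, he⟩
  choose e he using hex
  have hanti : ∀ k, L (k + 1) ≤ L k := fun k =>
    (⊤ : Subgroup G).lowerCentralSeries_antitone (Nat.le_succ k)
  have hne : ∀ k, k < n - 1 → L (k + 1) ≠ L k := by
    intro k hk heq
    have hst : ∀ j, L (k + j) = L k := by
      intro j
      induction j with
      | zero => rfl
      | succ j ih => rw [← add_assoc, hL, ih, ← hL, heq]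
    have h1 : L (n - 1) = ⊥ :=
      Subgroup.lowerCentralSeries_eq_bot_iff_nilpotencyClass_le.2 hclass.le
    have h2 : L k = ⊥ := by
      rw [← hst (n - 1 - k), ← h1]
      congr 1
      omega
    have := Subgroup.lowerCentralSeries_eq_bot_iff_nilpotencyClass_le.1 h2
    omega
  have hdec : ∀ k, k < n - 1 → e (k + 1) < e k := by
    intro k hk
    by_contra! hcon
    apply hne k hk
    apply Subgroup.eq_of_le_of_card_ge (hanti k)
    rw [he, he]
    exact Nat.pow_le_pow_right hp.pos hcon
  have h0 : e 0 = n := by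
    have h1 := he 0
    have h2 : Nat.card (L 0) = p ^ n := by
      rw [← hcard]; exact Subgroup.card_top
    rw [h2] at h1
    exact (Nat.pow_right_injective hp.two_le h1).symm
  have h1 : e 1 ≤ n - 2 := by
    by_contra! hcon
    have hlt : e 1 < e 0 := hdec 0 (by omega)
    have he1 : e 1 + 1 = n := by omega
    have hidx : (L 1).index = p := by
      have := Subgroup.card_mul_index (L 1)
      rw [he 1, hcard, ← he1, pow_succ] at this
      exact Nat.eq_of_mul_eq_mul_left (pow_pos hp.pos _) this
    have : IsCyclic (G ⧸ L 1) := isCyclic_of_prime_card (p := p) hidx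
    let f : G ⧸ L 2 →* G ⧸ L 1 := QuotientGroup.map _ _ (MonoidHom.id G) (hanti 1)
    have hf : f.ker ≤ Subgroup.center _ := by
      intro x hx
      induction x using QuotientGroup.induction_on with | H x =>
      have hx1 : x ∈ L 1 := (QuotientGroup.eq_one_iff x).1 hx
      rw [Subgroup.mem_center_iff]
      intro g
      induction g using QuotientGroup.induction_on with | H g =>
      have : ⁅x, g⁆ ∈ L 2 := Subgroup.commutator_mem_commutator hx1 trivial
      have h3 : QuotientGroup.mk' (L 2) ⁅x, g⁆ = 1 := (QuotientGroup.eq_one_iff _).2 this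
      rw [map_commutatorElement, commutatorElement_eq_one_iff_mul_comm] at h3
      exact h3.symm
    have hcomm := (f.isMulCommutative_of_isCyclic_of_ker_le_center hf).is_comm.comm
    apply hne 1 (by omega)
    refine le_antisymm (hanti 1) ?_
    rw [hL 0, Subgroup.commutator_le]
    intro a _ b _
    have h3 : QuotientGroup.mk' (L 2) ⁅a, b⁆ = 1 := by
      rw [map_commutatorElement, commutatorElement_eq_one_iff_mul_comm]
      exact hcomm _ _
    exact (QuotientGroup.eq_one_iff _).1 h3
  have hup : ∀ k, k + 1 ≤ n - 1 → e (k + 1) + k ≤ n - 2 := by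
    intro k
    induction k with
    | zero => intro _; exact h1
    | succ k ih =>
      intro hk
      have := ih (by omega)
      have := hdec (k + 1) (by omega)
      omega
  have hlow : ∀ j, j ≤ n - 1 → j ≤ e (n - 1 - j) := by
    intro j
    induction j with
    | zero => intro _; exact Nat.zero_le _
    | succ j ih =>
      intro hj
      have h3 := ih (by omega)
      have h4 := hdec (n - 1 - (j + 1)) (by omega)
      have h5 : n - 1 - (j + 1) + 1 = n - 1 - j := by omega
      rw [h5] at h4
      omega
  intro k hk1 hk2
  have h3 := hup (k - 1) (by omega)
  have h4 := hlow (n - 1 - k) (by omega)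
  have h5 : n - 1 - (n - 1 - k) = k := by omega
  have h6 : k - 1 + 1 = k := by omega
  rw [h5] at h4
  rw [h6] at h3
  have h7 : e k = n - 1 - k := by omega
  rw [← h7]
  exact he k

end MaxClassAux

/-- Baartmans–Woeppel: for an odd prime `p` and a `p`-group `G` of order `p ^ n`, `n ≥ 4`, of
maximal class (nilpotency class `n - 1`), `Aut G` has a normal Sylow `p`-subgroup `P` with a
complement `H`, and `H` is isomorphic to a subgroup of `C_(p-1) × C_(p-1)`. -/
theorem aut_of_maximal_class (p : ℕ) [Fact p.Prime] (hp : Odd p) (n : ℕ) (hn : 4 ≤ n)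
    (G : Type*) [Group G] [Finite G] [Group.IsNilpotent G]
    (hcard : Nat.card G = p ^ n) (hclass : Group.nilpotencyClass G = n - 1) :
    ∃ P : Sylow p (MulAut G), (P : Subgroup (MulAut G)).Normal ∧
      ∃ H : Subgroup (MulAut G), (P : Subgroup (MulAut G)).IsComplement' H ∧
        ∃ K : Subgroup (Multiplicative (ZMod (p - 1) × ZMod (p - 1))), Nonempty (H ≃* K) := by
  have hpp : p.Prime := Fact.out
  let L := (⊤ : Subgroup G).lowerCentralSeries
  have hc := MaxClassAux.lcs_card hn hcard hclass
  have c1 : Nat.card (L 1) = p ^ (n - 2) := by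
    have := hc 1 (by omega) (by omega)
    rwa [show n - 1 - 1 = n - 2 by omega] at this
  have c2 : Nat.card (L 2) = p ^ (n - 3) := by
    have := hc 2 (by omega) (by omega)
    rwa [show n - 1 - 2 = n - 3 by omega] at this
  have c3 : Nat.card (L 3) = p ^ (n - 4) := by
    have := hc 3 (by omega) (by omega)
    rwa [show n - 1 - 3 = n - 4 by omega] at this
  obtain ⟨P₁, hchar, hidx, hle⟩ := MaxClassAux.exists_char_max p (L 1) (L 2) (L 3) rfl rfl
    (by rw [c1, c2, ← pow_succ']; congr 1; omega) (by rw [c2, c3, ← pow_succ']; congr 1; omega)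
  have hle : L 1 ≤ P₁ := hle
  have hidx1 : (L 1).index = p * p := by
    have := Subgroup.card_mul_index (L 1)
    rw [c1, hcard, show n = n - 2 + 2 by omega, pow_add, Nat.add_sub_cancel] at this
    rw [← sq]
    exact Nat.eq_of_mul_eq_mul_left (pow_pos hpp.pos _) this
  have hrel : (L 1).relIndex P₁ = p := by
    have := Subgroup.relIndex_mul_index hle
    rw [hidx, hidx1] at this
    exact Nat.eq_of_mul_eq_mul_right hpp.pos this
  obtain ⟨χ₁, h₁⟩ := MaxClassAux.exists_section_char p P₁ (⊤ : Subgroup G)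
    (by rw [Subgroup.relIndex_top_right, hidx])
  obtain ⟨χ₂, h₂⟩ := MaxClassAux.exists_section_char p (L 1) P₁ hrel
  let e : Multiplicative (ZMod (p - 1)) × Multiplicative (ZMod (p - 1)) ≃*
      Multiplicative (ZMod (p - 1) × ZMod (p - 1)) := (MulEquiv.prodMultiplicative _ _).symm
  let χ : MulAut G →* Multiplicative (ZMod (p - 1) × ZMod (p - 1)) :=
    e.toMonoidHom.comp (χ₁.prod χ₂)
  have hχ : ∀ α, α ∈ χ.ker → χ₁ α = 1 ∧ χ₂ α = 1 := by
    intro α hα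
    have h1 : e (χ₁ α, χ₂ α) = 1 := hα
    have h2 := e.injective (h1.trans (map_one e).symm)
    exact Prod.ext_iff.1 h2
  have hpow : ∀ x : G, x ^ p ^ n = 1 := fun x => by rw [← hcard]; exact pow_card_eq_one'
  -- coprime elements of the kernel are trivial
  have htriv : ∀ α ∈ χ.ker, ∀ q : ℕ, Nat.Coprime q p → α ^ q = 1 → α = 1 := by
    intro α hα q hq hαq
    obtain ⟨hα1, hα2⟩ := hχ α hα
    have t1 : ∀ x, x⁻¹ * α x ∈ L 1 := fun x =>
      MaxClassAux.coprime_step hpow hq (L 1) P₁ α hαq (h₂ α hα2) x (h₁ α hα1 x trivial)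
    have t2 := MaxClassAux.triv_of_triv_ab hpow hq α hαq t1 (n - 2)
    have hbot : (⊤ : Subgroup G).lowerCentralSeries (n - 2 + 1) = ⊥ :=
      Subgroup.lowerCentralSeries_eq_bot_iff_nilpotencyClass_le.2 (by omega)
    ext x
    have := t2 x
    rw [hbot, Subgroup.mem_bot, inv_mul_eq_one] at this
    exact this.symm
  have hfin : Finite (MulAut G) := inferInstance
  have hPG : IsPGroup p χ.ker := by
    rw [isPGroup_iff_pow_pow_eq_one]
    rintro ⟨α, hα⟩
    obtain ⟨k, m, hm, hkm⟩ := Nat.exists_eq_pow_mul_and_not_dvd (orderOf_pos α).ne' p hpp.ne_one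
    refine ⟨k, Subtype.ext ?_⟩
    refine htriv (α ^ p ^ k) (Subgroup.pow_mem _ hα _) m
      ((Nat.Prime.coprime_iff_not_dvd hpp).2 hm).symm ?_
    rw [← pow_mul, ← hkm, pow_orderOf_eq_one]
  have hndvd : ¬ p ∣ χ.ker.index := by
    intro hd
    rw [Subgroup.index_ker] at hd
    have h1 := hd.trans (Subgroup.card_subgroup_dvd_card χ.range)
    rw [Nat.card_congr Multiplicative.toAdd, Nat.card_prod, Nat.card_zmod] at h1
    have h2 := Nat.le_of_dvd (by have := hpp.two_le; omega) ((or_self_iff).1 (hpp.dvd_mul.1 h1))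
    have := hpp.two_le
    omega
  have hcop : Nat.Coprime (Nat.card χ.ker) χ.ker.index := by
    obtain ⟨k, hk⟩ := IsPGroup.iff_card.1 hPG
    rw [hk]
    exact Nat.Coprime.pow_left k ((Nat.Prime.coprime_iff_not_dvd hpp).2 hndvd)
  obtain ⟨H, hH⟩ := Subgroup.exists_right_complement'_of_coprime hcop
  refine ⟨hPG.toSylow hndvd, ?_, H, ?_, ?_⟩
  · rw [IsPGroup.toSylow_coe]; infer_instance
  · rw [IsPGroup.toSylow_coe]; exact hH
  · have hinj : Function.Injective (χ.comp H.subtype) := by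
      rw [injective_iff_map_eq_one]
      intro x hx
      have hx' : (x : MulAut G) ∈ χ.ker := hx
      exact Subtype.ext (Subgroup.disjoint_def.1 hH.disjoint hx' x.2)
    exact ⟨(χ.comp H.subtype).range, ⟨MonoidHom.ofInjective hinj⟩⟩
end

section
/- If G is a finite p-group with nilpotent automorphism group, then either G is cyclic or Aut(G) is a p-group. -/
namespace Ying

open Subgroup

lemma commute_of_nil {A : Type*} [Group A] [Finite A] (hA : Group.IsNilpotent A)
    {p : ℕ} (hp : p.Prime) {a b : A} {n k : ℕ} (ha : a ^ p ^ k = 1) (hb : b ^ n = 1)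
    (hn : n.Coprime p) : a * b = b * a := by
  obtain ⟨e⟩ := (Group.isNilpotent_of_finite_tfae (G := A)).out 0 4 rfl rfl |>.mp hA
  apply e.symm.injective
  have ha' : (e.symm a) ^ p ^ k = 1 := by rw [← map_pow, ha, map_one]
  have hb' : (e.symm b) ^ n = 1 := by rw [← map_pow, hb, map_one]
  rw [map_mul, map_mul]
  generalize e.symm a = u at *
  generalize e.symm b = v at *
  funext q P
  have ha2 : (u q P) ^ p ^ k = 1 := congrFun (congrFun ha' q) P
  have hb2 : (v q P) ^ n = 1 := congrFun (congrFun hb' q) P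
  have hq : (q : ℕ).Prime := Nat.prime_of_mem_primeFactors q.2
  have key : ∀ (w : (P : Subgroup A)) (m : ℕ), w ^ m = 1 → m.Coprime q → w = 1 := by
    intro w m hw hm
    obtain ⟨j, hj⟩ := P.isPGroup' w
    rw [← orderOf_eq_one_iff]
    exact Nat.eq_one_of_dvd_coprimes (hm.pow_right j) (orderOf_dvd_of_pow_eq_one hw)
      (orderOf_dvd_of_pow_eq_one hj)
  simp only [Pi.mul_apply]
  by_cases hqp : (q : ℕ) = p
  · rw [key (v q P) n hb2 (hqp ▸ hn)]; simp
  · rw [key (u q P) _ ha2 (((Nat.coprime_primes hp hq).2 (Ne.symm hqp)).pow_left k)]; simp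

lemma exists_index {p : ℕ} [Fact p.Prime] (H : Type*) [Group H] [Finite H] [Nontrivial H]
    (hH : IsPGroup p H) : ∃ N : Subgroup H, N.Normal ∧ N.index = p := by
  have hp : p.Prime := Fact.out
  obtain ⟨n, hn⟩ := IsPGroup.iff_card.1 hH
  have h1 : 1 < Nat.card H := Finite.one_lt_card
  cases n with
  | zero => simp at hn; omega
  | succ n =>
    obtain ⟨K, hK⟩ := Sylow.exists_subgroup_card_pow_prime (G := H) p (n := n)
      (hn ▸ pow_dvd_pow p (Nat.le_succ n))
    have hi : K.index = p := by
      have := K.card_mul_index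
      rw [hK, hn, pow_succ] at this
      exact Nat.eq_of_mul_eq_mul_left (pow_pos hp.pos n) this
    refine ⟨K, normal_of_index_eq_minFac_card ?_, hi⟩
    rw [hi, hn, hp.pow_minFac (by omega)]

lemma exists_hom {p : ℕ} [Fact p.Prime] {H G : Type*} [Group H] [Group G] (N : Subgroup H)
    [N.Normal] (hN : N.index = p) (z : G) (hz : orderOf z = p) :
    ∃ f : H →* G, (∀ x ∈ N, f x = 1) ∧ (∀ x, f x ∈ zpowers z) ∧ ∃ x, f x = z := by
  let e : H ⧸ N ≃* zpowers z := mulEquivOfPrimeCardEq (p := p) hN (by rw [Nat.card_zpowers, hz])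
  refine ⟨(zpowers z).subtype.comp (e.toMonoidHom.comp (QuotientGroup.mk' N)), ?_, ?_, ?_⟩
  · intro x hx
    have : (QuotientGroup.mk' N) x = 1 := by simpa using hx
    simp only [MonoidHom.comp_apply, this, map_one]
  · intro x; exact SetLike.coe_mem _
  · obtain ⟨y, hy⟩ := e.surjective ⟨z, mem_zpowers z⟩
    obtain ⟨x, rfl⟩ := QuotientGroup.mk'_surjective N y
    exact ⟨x, congrArg Subtype.val hy⟩

section
variable {p : ℕ} [Fact p.Prime] {G : Type*} [Group G] [Finite G]

/-- transvection -/
lemma comm_f (hnil : Group.IsNilpotent (MulAut G)) (f : G →* G)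
    (hc : ∀ x, f x ∈ center G) (hff : ∀ x, f (f x) = 1) (hfp : ∀ x, f x ^ p = 1)
    {α : MulAut G} {n : ℕ} (hn : n.Coprime p) (hα : α ^ n = 1) (x : G) :
    α (f x) = f (α x) := by
  have hcm : ∀ x y, f x * y = y * f x := fun x y => (mem_center_iff.1 (hc x) y).symm
  let τ : MulAut G :=
    { toFun := fun x => x * f x
      invFun := fun x => x * (f x)⁻¹
      left_inv := fun x => by simp [hff]
      right_inv := fun x => by simp [hff]
      map_mul' := fun x y => by
        simp only [map_mul]
        rw [mul_assoc, mul_assoc, ← mul_assoc y, ← hcm x y, ← mul_assoc (f x)] }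
  have hτ : ∀ (m : ℕ) x, (τ ^ m) x = x * f x ^ m := by
    intro m
    induction m with
    | zero => simp
    | succ m ih =>
      intro x
      rw [pow_succ, MulAut.mul_apply, ih]
      change x * f x * (f (x * f x)) ^ m = _
      rw [map_mul, hff, mul_one, pow_succ', mul_assoc]
  have hτp : τ ^ p ^ 1 = 1 := by
    ext x; rw [pow_one, hτ, hfp]; simp
  have := commute_of_nil hnil (Fact.out : p.Prime) hτp hα hn
  have h2 := congrArg (fun g : MulAut G => g x) this
  change α x * f (α x) = α (x * f x) at h2
  rw [map_mul] at h2
  exact (mul_left_cancel h2).symm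

lemma central (hG : IsPGroup p G) (hnil : Group.IsNilpotent (MulAut G))
    {α : MulAut G} {n : ℕ} (hn : n.Coprime p) (hα : α ^ n = 1) (x : G) :
    x⁻¹ * α x ∈ center G := by
  obtain ⟨k, hk⟩ := hG x
  have hk' : (MulAut.conj x) ^ p ^ k = 1 := by rw [← map_pow, hk, map_one]
  have := commute_of_nil hnil (Fact.out : p.Prime) hk' hα hn
  rw [mem_center_iff]
  intro y
  have h2 := congrArg (fun g : MulAut G => g (α⁻¹ y)) this
  simp only [MulAut.mul_apply, MulAut.conj_apply, MulAut.apply_inv_self, map_mul, map_inv] at h2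
  have h3 : y = x⁻¹ * (α x * y * (α x)⁻¹) * x := by rw [← h2]; group
  calc y * (x⁻¹ * α x) = (x⁻¹ * (α x * y * (α x)⁻¹) * x) * (x⁻¹ * α x) := by rw [← h3]
    _ = _ := by group

/-- displacement -/
def disp (α : MulAut G) (h : ∀ x, x⁻¹ * α x ∈ center G) : G →* center G :=
  MonoidHom.mk' (fun x => ⟨x⁻¹ * α x, h x⟩) (by
    intro x y
    ext
    simp only [map_mul, Subgroup.coe_mul]
    have := mem_center_iff.1 (h x) y⁻¹
    calc (x * y)⁻¹ * (α x * α y) = (y⁻¹ * (x⁻¹ * α x)) * α y := by group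
      _ = _ := by rw [this]; group)

open scoped IsMulCommutative in
lemma exists_proj (hG : IsPGroup p G) (hnil : Group.IsNilpotent (MulAut G))
    {α : MulAut G} {n : ℕ} (hn : n.Coprime p) (hα : α ^ n = 1) :
    ∃ π : G →* G, (∀ x, α (π x) = π x) ∧ (∀ x, α x = x → π x = x) ∧
      (∀ x, x⁻¹ * π x ∈ center G) := by
  have hαi : ∀ i, (α ^ i) ^ n = 1 := fun i => by rw [← pow_mul, mul_comm, pow_mul, hα, one_pow]
  let δ : ℕ → G →* center G := fun i => disp (α ^ i) (central hG hnil hn (hαi i))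
  have hδ : ∀ i x, (δ i x : G) = x⁻¹ * (α ^ i) x := fun i x => rfl
  let Z : G →* center G := ∏ i ∈ Finset.range n, δ i
  have hZ : ∀ x, Z x = ∏ i ∈ Finset.range n, δ i x := fun x => by
    simp [Z, MonoidHom.finsetProd_apply]
  have h0 : ∀ x, δ 0 x = 1 := fun x => by ext; simp [hδ]
  have hnn : ∀ x, δ n x = 1 := fun x => by ext; simp [hδ, hα]
  let ac := Subgroup.centerCongr α
  have hac : ∀ z, (ac z : G) = α z := fun z => rfl
  have hs : ∀ i x, ac (δ i x) = δ (i+1) x * (δ 1 x)⁻¹ := by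
    intro i x
    rw [mul_comm]
    ext
    rw [hac, hδ, Subgroup.coe_mul, Subgroup.coe_inv, hδ, hδ, map_mul, pow_one, pow_succ', map_inv,
      MulAut.mul_apply]
    group
  have hacZ : ∀ x, ac (Z x) = Z x * (δ 1 x ^ n)⁻¹ := by
    intro x
    rw [hZ, map_prod]
    simp only [hs, Finset.prod_mul_distrib, Finset.prod_const, Finset.card_range, inv_pow]
    congr 1
    have h1 := Finset.prod_range_succ (fun i => δ i x) n
    have h2 := Finset.prod_range_succ' (fun i => δ i x) n
    rw [hnn, mul_one] at h1
    rw [h0, mul_one] at h2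
    rw [← h1, ← h2]
  have hcop : (Nat.card G).Coprime n := by
    obtain ⟨m, hm⟩ := IsPGroup.iff_card.1 hG
    rw [hm]; exact (hn.symm).pow_left m
  obtain ⟨k, hk⟩ : ∃ k : ℤ, ∀ z : center G, (z ^ n) ^ k = z := by
    refine ⟨Nat.gcdB (Nat.card G) n, fun z => ?_⟩
    have h := Nat.gcd_eq_gcd_ab (Nat.card G) n
    rw [hcop.gcd_eq_one] at h
    have hz : z ^ Nat.card G = 1 := by ext; simp
    calc (z ^ n) ^ Nat.gcdB (Nat.card G) n
        = (z ^ Nat.card G) ^ Nat.gcdA (Nat.card G) n * (z ^ n) ^ Nat.gcdB (Nat.card G) n := by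
          rw [hz]; simp
      _ = z ^ ((Nat.card G : ℤ) * Nat.gcdA (Nat.card G) n + n * Nat.gcdB (Nat.card G) n) := by
          rw [zpow_add, zpow_mul, zpow_mul, zpow_natCast, zpow_natCast]
      _ = z := by rw [← h]; simp
  refine ⟨MonoidHom.mk' (fun x => x * (Z x ^ k : center G)) ?_, ?_, ?_, ?_⟩
  · intro x y
    rw [map_mul, mul_zpow, Subgroup.coe_mul]
    have := mem_center_iff.1 (Z x ^ k).2 y
    rw [mul_assoc, mul_assoc, ← mul_assoc y, this]
    simp only [mul_assoc]
  · intro x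
    simp only [MonoidHom.mk'_apply, map_mul]
    rw [← hac, map_zpow, hacZ, mul_zpow, inv_zpow, hk, mul_comm, Subgroup.coe_mul, ← mul_assoc]
    congr 1
    have h1 : α x = x * (δ 1 x : G) := by rw [hδ]; simp
    rw [h1, mul_assoc, ← Subgroup.coe_mul]
    simp
  · intro x hx
    have hi : ∀ i, (α ^ i) x = x := by
      intro i
      induction i with
      | zero => simp
      | succ i ih => rw [pow_succ, MulAut.mul_apply, hx, ih]
    have : Z x = 1 := by
      rw [hZ]; apply Finset.prod_eq_one; intro i _; ext; simp [hδ, hi]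
    simp [this]
  · intro x
    simp only [MonoidHom.mk'_apply, inv_mul_cancel_left]
    exact SetLike.coe_mem _

lemma fpf (hG : IsPGroup p G) (hnil : Group.IsNilpotent (MulAut G))
    {α : MulAut G} {n : ℕ} (hn : n.Coprime p) (hα : α ^ n = 1) (h1 : α ≠ 1) :
    ∀ x, α x = x → x = 1 := by
  by_contra! hne
  obtain ⟨c, hc, hc1⟩ := hne
  obtain ⟨π, hπ1, hπ2, hπ3⟩ := exists_proj hG hnil hn hα
  have hK : π.ker ≠ ⊥ := by
    intro hb
    have hinj : Function.Injective π := (MonoidHom.ker_eq_bot_iff π).1 hb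
    have hsur := Finite.surjective_of_injective hinj
    apply h1
    ext y
    obtain ⟨x, rfl⟩ := hsur y
    simpa using hπ1 x
  have : Nontrivial π.ker := (Subgroup.nontrivial_iff_ne_bot _).2 hK
  have hdvd : p ∣ Nat.card π.ker := by
    obtain ⟨m, hm0, hm⟩ := ((hG.to_subgroup π.ker).nontrivial_iff_card).1 this
    rw [hm]; exact dvd_pow_self p (by omega)
  obtain ⟨⟨z, hzK⟩, hz⟩ := exists_prime_orderOf_dvd_card' p hdvd
  rw [Subgroup.orderOf_mk] at hz
  have hπz : π z = 1 := hzK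
  have hzc : z ∈ center G := by
    have := hπ3 z
    rw [hπz, mul_one] at this
    simpa using this
  have : Nontrivial π.range :=
    ⟨⟨⟨c, c, hπ2 c hc⟩, 1, fun h => hc1 (congrArg Subtype.val h)⟩⟩
  obtain ⟨N, hN, hNi⟩ := exists_index (p := p) π.range (hG.to_subgroup _)
  obtain ⟨φ, -, hφ2, ⟨⟨x, x', hx'⟩, hφ3⟩⟩ := exists_hom N hNi z hz
  let f := φ.comp π.rangeRestrict
  have hfz : f z = 1 := by
    have : π.rangeRestrict z = 1 := by ext; simpa using hπz
    simp [f, this]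
  have hfm : ∀ x, f x ∈ zpowers z := fun x => hφ2 _
  have hxx : α x = x := by rw [← hx']; exact hπ1 x'
  have hfx : f x = z := by
    rw [← hφ3]
    change φ _ = φ _
    congr 1
    ext
    exact hπ2 x hxx
  have := comm_f (p := p) hnil f (fun x => (zpowers_le.2 hzc) (hfm x))
    (fun x => by
      obtain ⟨j, hj⟩ := mem_zpowers_iff.1 (hfm x)
      rw [← hj, map_zpow, hfz, one_zpow])
    (fun x => by
      obtain ⟨j, hj⟩ := mem_zpowers_iff.1 (hfm x)
      rw [← hj, ← zpow_natCast, zpow_comm, zpow_natCast, ← hz, pow_orderOf_eq_one, one_zpow])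
    hn hα x
  rw [hxx, hfx] at this
  have h3 := hπ2 z this
  rw [hπz] at h3
  rw [← h3, orderOf_one] at hz
  exact (Fact.out : p.Prime).one_lt.ne hz

lemma abel (hG : IsPGroup p G) (hnil : Group.IsNilpotent (MulAut G))
    {α : MulAut G} {n : ℕ} (hn : n.Coprime p) (hα : α ^ n = 1) (h1 : α ≠ 1) (x y : G) :
    x * y = y * x := by
  obtain ⟨π, hπ1, hπ2, hπ3⟩ := exists_proj hG hnil hn hα
  have h2 := hπ3 y
  rw [fpf hG hnil hn hα h1 _ (hπ1 y), mul_one] at h2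
  exact mem_center_iff.1 (by simpa using h2) x

lemma case_two (hp2 : p = 2) (hG : IsPGroup p G) (hnil : Group.IsNilpotent (MulAut G))
    {α : MulAut G} {n : ℕ} (hn : n.Coprime p) (hα : α ^ n = 1) (h1 : α ≠ 1) : IsCyclic G := by
  by_contra hcyc
  have : Nontrivial G := by
    by_contra h
    rw [not_nontrivial_iff_subsingleton] at h
    exact hcyc inferInstance
  obtain ⟨N, hN, hNi⟩ := exists_index (p := p) G hG
  have hNb : N ≠ ⊥ := by
    rintro rfl
    rw [Subgroup.index_bot] at hNi
    exact hcyc (isCyclic_of_prime_card hNi)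
  have : Nontrivial N := (Subgroup.nontrivial_iff_ne_bot _).2 hNb
  have hdvd : p ∣ Nat.card N := by
    obtain ⟨m, hm0, hm⟩ := ((hG.to_subgroup N).nontrivial_iff_card).1 this
    rw [hm]; exact dvd_pow_self p (by omega)
  obtain ⟨⟨z, hzK⟩, hz⟩ := exists_prime_orderOf_dvd_card' p hdvd
  rw [Subgroup.orderOf_mk] at hz
  obtain ⟨f, hf1, hfm, ⟨x, hx⟩⟩ := exists_hom N hNi z hz
  have hz2 : z ^ 2 = 1 := by rw [← hp2, ← hz, pow_orderOf_eq_one]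
  have hz1 : z ≠ 1 := by
    rintro rfl
    rw [orderOf_one] at hz; omega
  have := comm_f (p := p) hnil f
    (fun x => mem_center_iff.2 fun y => abel hG hnil hn hα h1 _ _)
    (fun x => by
      obtain ⟨j, hj⟩ := mem_zpowers_iff.1 (hfm x)
      rw [← hj, map_zpow, hf1 z hzK, one_zpow])
    (fun x => by
      obtain ⟨j, hj⟩ := mem_zpowers_iff.1 (hfm x)
      rw [← hj, ← zpow_natCast, zpow_comm, zpow_natCast, ← hz, pow_orderOf_eq_one, one_zpow])
    hn hα x
  rw [hx] at this
  obtain ⟨j, hj⟩ := mem_zpowers_iff.1 (hfm (α x))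
  rw [← this] at hj
  rcases Int.even_or_odd' j with ⟨m, rfl | rfl⟩
  · rw [zpow_mul, zpow_ofNat, hz2, one_zpow] at hj
    exact hz1 (α.injective (by rw [← hj, map_one]))
  · rw [zpow_add, zpow_mul, zpow_ofNat, hz2, one_zpow, one_mul, zpow_one] at hj
    exact hz1 (fpf hG hnil hn hα h1 z hj.symm)

lemma case_odd (hp2 : p ≠ 2) (hG : IsPGroup p G) (hnil : Group.IsNilpotent (MulAut G))
    (hab : ∀ x y : G, x * y = y * x) : IsCyclic G := by
  classical
  letI : CommGroup G := { ‹Group G› with mul_comm := hab }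
  obtain ⟨ι, _, n, hn, ⟨e⟩⟩ := CommGroup.equiv_prod_multiplicative_zmod_of_finite G
  by_cases hι : Subsingleton ι
  · rcases isEmpty_or_nonempty ι with h | ⟨⟨i⟩⟩
    · have : Subsingleton G := e.toEquiv.subsingleton
      infer_instance
    · letI : Unique ι := uniqueOfSubsingleton i
      have e2 := e.trans (MulEquiv.piUnique fun i => Multiplicative (ZMod (n i)))
      exact isCyclic_of_surjective e2.symm e2.symm.surjective
  · rw [not_subsingleton_iff_nontrivial] at hι
    obtain ⟨i, j, hij⟩ := exists_pair_ne ι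
    exfalso
    let X := (i : ι) → Multiplicative (ZMod (n i))
    let β : MulAut X := MulEquiv.piCongrRight fun l => if l = i then MulEquiv.inv _ else 1
    have hβi : ∀ x, β x i = (x i)⁻¹ := fun x => by
      change (if i = i then MulEquiv.inv _ else (1 : MulAut (Multiplicative (ZMod (n i))))) (x i) = _
      rw [if_pos rfl]; rfl
    have hβl : ∀ x l, l ≠ i → β x l = x l := fun x l hl => by
      change (if l = i then MulEquiv.inv _ else (1 : MulAut (Multiplicative (ZMod (n l))))) (x l) = _
      rw [if_neg hl]; rfl
    have hβ2 : β ^ 2 = 1 := by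
      apply MulEquiv.ext
      intro x
      funext l
      rw [pow_two, MulAut.mul_apply, MulAut.one_apply]
      by_cases hl : l = i
      · subst hl; rw [hβi, hβi, inv_inv]
      · rw [hβl _ _ hl, hβl _ _ hl]
    have hβj : β (Pi.mulSingle j (Multiplicative.ofAdd 1)) =
        Pi.mulSingle j (Multiplicative.ofAdd 1) := by
      funext l
      by_cases hl : l = i
      · subst hl
        rw [hβi]
        simp [hij]
      · exact hβl _ _ hl
    let α : MulAut G := (e.trans β).trans e.symm
    have hαx : ∀ x, α x = e.symm (β (e x)) := fun x => rfl
    have hα2 : α ^ 2 = 1 := by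
      ext x
      rw [pow_two, MulAut.mul_apply, hαx, hαx, e.apply_symm_apply, ← MulAut.mul_apply, ← pow_two,
        hβ2]
      simp
    have h2p : Nat.Coprime 2 p :=
      (Nat.coprime_primes Nat.prime_two (Fact.out : p.Prime)).2 (Ne.symm hp2)
    have hne : ∀ l, (Pi.mulSingle l (Multiplicative.ofAdd 1) : X) ≠ 1 := by
      intro l h
      have := congrFun h l
      have : Fact (1 < n l) := ⟨hn l⟩
      simp_all
    by_cases h1 : α = 1
    · have hs : ∀ x : X, β x = x := by
        intro x
        have := hαx (e.symm x)
        rw [h1] at this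
        simpa using this.symm
      have h3 : (Pi.mulSingle i (Multiplicative.ofAdd 1) : X) ^ 2 = 1 := by
        funext l
        have h4 := congrFun (hs (Pi.mulSingle i (Multiplicative.ofAdd 1))) l
        by_cases hl : l = i
        · subst hl
          rw [hβi, Pi.mulSingle_eq_same] at h4
          simp only [Pi.pow_apply, Pi.mulSingle_eq_same, Pi.one_apply, pow_two]
          nth_rewrite 1 [← h4]
          exact inv_mul_cancel _
        · simp [hl]
      have hX : IsPGroup p X := hG.of_equiv e
      obtain ⟨k, hk⟩ := hX (Pi.mulSingle i (Multiplicative.ofAdd 1))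
      apply hne i
      rw [← orderOf_eq_one_iff]
      exact Nat.eq_one_of_dvd_coprimes (h2p.pow_right k) (orderOf_dvd_of_pow_eq_one h3)
        (orderOf_dvd_of_pow_eq_one hk)
    · have := fpf hG hnil h2p hα2 h1 (e.symm (Pi.mulSingle j (Multiplicative.ofAdd 1)))
        (by rw [hαx, e.apply_symm_apply, hβj])
      exact hne j (by simpa using this)

end
end Ying

/-- Ying's theorem: if `G` is a finite `p`-group with nilpotent automorphism group, then
either `G` is cyclic or `Aut G` is a `p`-group. -/
theorem cyclic_or_aut_isPGroup (p : ℕ) [Fact p.Prime] (G : Type*) [Group G] [Finite G]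
    (hG : IsPGroup p G) (hnil : Group.IsNilpotent (MulAut G)) :
    IsCyclic G ∨ IsPGroup p (MulAut G) := by
  by_cases hP : IsPGroup p (MulAut G)
  · exact Or.inr hP
  left
  have hp : p.Prime := Fact.out
  obtain ⟨q, hq, hqd, hqp⟩ : ∃ q : ℕ, q.Prime ∧ q ∣ Nat.card (MulAut G) ∧ q ≠ p := by
    by_contra! h
    exact hP (IsPGroup.of_card (Nat.eq_prime_pow_of_unique_prime_dvd Nat.card_pos.ne'
      (fun {d} hd hdd => h d hd hdd)))
  haveI : Fact q.Prime := ⟨hq⟩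
  obtain ⟨α, hα⟩ := exists_prime_orderOf_dvd_card' q hqd
  have hαq : α ^ q = 1 := by rw [← hα, pow_orderOf_eq_one]
  have h1 : α ≠ 1 := by
    rintro rfl
    rw [orderOf_one] at hα
    exact hq.one_lt.ne hα
  have hn : q.Coprime p := (Nat.coprime_primes hq hp).2 hqp
  by_cases hp2 : p = 2
  · exact Ying.case_two hp2 hG hnil hn hαq h1
  · exact Ying.case_odd hp2 hG hnil (Ying.abel hG hnil hn hαq h1)
end

section
/- For every prime p, p-group P₁ and p-group P₂, both nontrivial, the set of primes dividing |Aut(P₁ ≀ P₂)| equals the union of the sets of primes dividing |Aut(P₁)| and |Aut(P₂)| together with {p}. -/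
/-- The action of `P₂` on `P₂ → P₁` permuting the coordinates (by left translation on the
index), used to build the regular wreath product. -/
def wreathAction (P₁ P₂ : Type*) [Group P₁] [Group P₂] : P₂ →* MulAut (P₂ → P₁) where
  toFun b :=
    { toFun := fun f x => f (b⁻¹ * x)
      invFun := fun f x => f (b * x)
      left_inv := fun f => by ext x; simp
      right_inv := fun f => by ext x; simp
      map_mul' := fun f g => rfl }
  map_one' := by ext f x; simp
  map_mul' b c := by ext f x; simp [mul_assoc]

/-- The regular wreath product `P₁ ≀ P₂`: the semidirect product of `P₂ → P₁` by `P₂`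
acting by permuting coordinates. -/
def WreathProduct (P₁ P₂ : Type*) [Group P₁] [Group P₂] : Type _ :=
  SemidirectProduct (P₂ → P₁) P₂ (wreathAction P₁ P₂)

instance (P₁ P₂ : Type*) [Group P₁] [Group P₂] : Group (WreathProduct P₁ P₂) :=
  inferInstanceAs (Group (SemidirectProduct (P₂ → P₁) P₂ (wreathAction P₁ P₂)))

namespace Hor
open RegularWreathProduct
variable {P Q : Type*} [Group P] [Group Q]

open Classical in
/-- single-coordinate element -/
noncomputable def sg (a : P) (x : Q) : P ≀ᵣ Q := ⟨Pi.mulSingle x a, 1⟩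

@[simp] lemma sg_right (a : P) (x : Q) : (sg a x).right = 1 := rfl
@[simp] lemma sg_left_same (a : P) (x : Q) : (sg a x).left x = a := by simp [sg]
lemma sg_left_ne (a : P) (x t : Q) (h : t ≠ x) : (sg a x).left t = 1 := by simp [sg, h]

/-- commutator -/
noncomputable def cm (a : P) (x : Q) (b : P ≀ᵣ Q) : P ≀ᵣ Q := sg a x * b * (sg a x)⁻¹ * b⁻¹

@[simp] lemma cm_right (a : P) (x : Q) (b : P ≀ᵣ Q) : (cm a x b).right = 1 := by simp [cm]
lemma cm_left (a : P) (x : Q) (b : P ≀ᵣ Q) (t : Q) : (cm a x b).left t =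
    (sg a x).left t * b.left t * ((sg a x).left (b.right⁻¹ * t))⁻¹ * (b.left t)⁻¹ := by
  simp [cm]
lemma cm_left_x (a : P) (x : Q) (b : P ≀ᵣ Q) (h : b.right ≠ 1) : (cm a x b).left x = a := by
  rw [cm_left, sg_left_same, sg_left_ne _ _ (b.right⁻¹ * x)]
  · simp
  · simpa using h
lemma cm_left_yx (a : P) (x : Q) (b : P ≀ᵣ Q) (h : b.right ≠ 1) : (cm a x b).left (b.right * x) =
    b.left (b.right * x) * a⁻¹ * (b.left (b.right * x))⁻¹ := by
  rw [cm_left, sg_left_ne _ _ (b.right * x)]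
  · simp
  · simpa using h
lemma cm_left_ne (a : P) (x : Q) (b : P ≀ᵣ Q) (t : Q) (h : t ≠ x) (h' : t ≠ b.right * x) :
    (cm a x b).left t = 1 := by
  rw [cm_left, sg_left_ne _ _ t h, sg_left_ne]
  · simp
  · intro e; apply h'; rw [← e]; simp

lemma comm_base {w b : P ≀ᵣ Q} (hw : w.right = 1) (h : w * b = b * w) (t : Q) :
    w.left t * b.left t = b.left t * w.left (b.right⁻¹ * t) := by
  have := congrArg (fun g => g.left t) h
  simpa [hw] using this

/-- Step A -/
lemma stepA (hne : ∃ a : P, a * a ≠ 1) (b : P ≀ᵣ Q)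
    (hb : ∀ g : P ≀ᵣ Q, (g * b * g⁻¹) * b = b * (g * b * g⁻¹)) : b.right = 1 := by
  by_contra h
  obtain ⟨a, ha⟩ := hne
  have hc : cm a 1 b * b = b * cm a 1 b := by
    have := hb (sg a 1)
    have h2 : sg a 1 * b * (sg a 1)⁻¹ = cm a 1 b * b := by simp [cm]
    rw [h2] at this
    apply mul_right_cancel (b := b)
    rw [this]; group
  have h3 := comm_base (cm_right a 1 b) hc (b.right * 1)
  rw [cm_left_yx a 1 b h] at h3
  simp only [inv_mul_cancel_left, cm_left_x a 1 b h] at h3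
  simp at h3
  apply ha
  nth_rewrite 1 [← h3]; simp

/-- central base -/
def Zb (g : P ≀ᵣ Q) : Prop := g.right = 1 ∧ ∀ x a, g.left x * a = a * g.left x

lemma Zb_comm {z g : P ≀ᵣ Q} (hz : Zb z) (hg : g.right = 1) : z * g = g * z := by
  ext t
  · simp [hg, hz.1, hz.2]
  · simp [hg, hz.1]

lemma Zb_conj {z : P ≀ᵣ Q} (hz : Zb z) (g : P ≀ᵣ Q) : Zb (g * z * g⁻¹) := by
  refine ⟨by simp [hz.1], fun x a => ?_⟩
  have : (g * z * g⁻¹).left x = z.left (g.right⁻¹ * x) := by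
    simp [hz.1]
    rw [← hz.2]; simp
  rw [this, hz.2]

lemma right_of_comm {p : ℕ} [Fact p.Prime] [Finite P] [Nontrivial P] (hP : IsPGroup p P)
    (g : P ≀ᵣ Q) (h : ∀ z : P ≀ᵣ Q, Zb z → z * g = g * z) : g.right = 1 := by
  by_contra hy
  have := hP.center_nontrivial
  obtain ⟨⟨a, hac⟩, ha⟩ := exists_ne (1 : Subgroup.center P)
  have ha' : a ≠ 1 := fun e => ha (Subtype.ext e)
  rw [Subgroup.mem_center_iff] at hac
  have hz : Zb (sg a (1:Q)) := by
    refine ⟨rfl, fun x b => ?_⟩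
    by_cases hx : x = 1
    · subst hx; simp [hac]
    · simp [sg_left_ne _ _ _ hx]
  have := comm_base rfl (h _ hz) g.right
  rw [sg_left_ne _ _ _ hy] at this
  simp at this
  exact ha' this

lemma base_of_ne {p : ℕ} [Fact p.Prime] [Finite P] [Finite Q] [Nontrivial P] (hP : IsPGroup p P)
    (hne : ∃ a : P, a * a ≠ 1) (α : MulAut (P ≀ᵣ Q)) (b₀ : P ≀ᵣ Q) (hb : b₀.right = 1) :
    (α b₀).right = 1 := by
  by_contra hy
  have hA : ∀ z, Zb z → (α z).right = 1 := by
    intro z hz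
    apply stepA hne
    intro g
    obtain ⟨g, rfl⟩ := α.surjective g
    simp only [← map_mul, ← map_inv]
    rw [← Zb_comm hz (Zb_conj hz g).1]
  have hB : ∀ z, Zb z → Zb (α z) := by
    intro z hz
    refine ⟨hA z hz, fun x a => ?_⟩
    have hc : α z * cm a x (α b₀) = cm a x (α b₀) * α z := by
      obtain ⟨g, hg⟩ := α.surjective (sg a x)
      rw [cm, ← hg]
      simp only [← map_mul, ← map_inv]
      rw [Zb_comm hz]
      simp [hb]
    have := comm_base (hA z hz) hc x
    rw [cm_left_x _ _ _ hy] at this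
    simpa using this
  apply hy
  apply right_of_comm hP
  have hsurj : Function.Surjective (fun z : {z : P ≀ᵣ Q // Zb z} => (⟨α z.1, hB _ z.2⟩ : {z : P ≀ᵣ Q // Zb z})) := by
    apply Finite.surjective_of_injective
    intro z w h
    exact Subtype.ext (α.injective (congrArg Subtype.val h))
  intro z hz
  obtain ⟨⟨w, hw⟩, e⟩ := hsurj ⟨z, hz⟩
  have e : α w = z := congrArg Subtype.val e
  rw [← e, ← map_mul, Zb_comm hw hb, map_mul]

/-- α preserves base -/
def Pres (α : MulAut (P ≀ᵣ Q)) : Prop := ∀ b : P ≀ᵣ Q, b.right = 1 → (α b).right = 1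

lemma Pres.inv [Finite P] [Finite Q] {α : MulAut (P ≀ᵣ Q)} (h : Pres α) : Pres α⁻¹ := by
  have hsurj : Function.Surjective (fun z : {z : P ≀ᵣ Q // z.right = 1} =>
      (⟨α z.1, h _ z.2⟩ : {z : P ≀ᵣ Q // z.right = 1})) := by
    apply Finite.surjective_of_injective
    intro z w h
    exact Subtype.ext (α.injective (congrArg Subtype.val h))
  intro b hb
  obtain ⟨⟨w, hw⟩, e⟩ := hsurj ⟨b, hb⟩
  have e : α w = b := congrArg Subtype.val e
  rw [← e]; simpa using hw

lemma Pres.mul {α β : MulAut (P ≀ᵣ Q)} (h : Pres α) (h' : Pres β) : Pres (α * β) :=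
  fun b hb => h _ (h' b hb)

lemma Pres.pow {α : MulAut (P ≀ᵣ Q)} (h : Pres α) (n : ℕ) : Pres (α ^ n) := by
  induction n with
  | zero => intro b hb; simpa using hb
  | succ n ih => rw [pow_succ]; exact ih.mul h

section exp2
variable (h2 : ∀ a : P, a * a = 1)
include h2

lemma comm2 (a b : P) : a * b = b * a := by
  have := h2 (a * b)
  have ha := h2 a
  have hb := h2 b
  calc a * b = a * (a * b * (a * b)) * b := by rw [this]; simp
    _ = (a * a) * (b * a) * (b * b) := by simp only [mul_assoc]
    _ = b * a := by rw [ha, hb]; simp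

lemma base_comm {g h : P ≀ᵣ Q} (hg : g.right = 1) (hh : h.right = 1) : g * h = h * g :=
  Zb_comm ⟨hg, fun _ _ => comm2 h2 _ _⟩ hh

lemma inv_y {w b : P ≀ᵣ Q} (hw : w.right = 1) (h : w * b = b * w) (t : Q) :
    w.left (b.right * t) = w.left t := by
  have := comm_base hw h (b.right * t)
  rw [comm2 h2] at this
  simpa using this

lemma uniq_y (α : MulAut (P ≀ᵣ Q)) {a : P} (ha : a ≠ 1) {b c : P ≀ᵣ Q} (hb : b.right = 1) (hc : c.right = 1)
    (hb' : (α b).right ≠ 1) (hc' : (α c).right ≠ 1) : (α b).right = (α c).right := by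
  by_contra hn
  have hcm : cm a 1 (α b) * α c = α c * cm a 1 (α b) := by
    obtain ⟨g, hg⟩ := α.surjective (sg a 1)
    rw [cm, ← hg]
    simp only [← map_mul, ← map_inv]
    rw [base_comm h2 _ hc]
    simp [hb]
  have := inv_y h2 (cm_right _ _ _) hcm 1
  rw [cm_left_x _ _ _ hb', cm_left_ne] at this
  · exact ha this.symm
  · simpa using hc'
  · simpa using fun e => hn (e.symm)

lemma small [Finite P] [Finite Q] (α : MulAut (P ≀ᵣ Q)) (hα : ¬ Pres α) :
    ∃ y : Q, y ≠ 1 ∧ (∀ x : Q, x = 1 ∨ x = y) ∧ ∀ a b : P, a ≠ 1 → b ≠ 1 → a = b := by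
  have hα' : ¬ Pres α⁻¹ := fun h => hα (by simpa using h.inv)
  unfold Pres at hα'
  push Not at hα'
  obtain ⟨b, hb, hy⟩ := hα'
  set b1 := α⁻¹ b with hb1
  have hM : ∀ h : P ≀ᵣ Q, h.right = 1 → (α h).right = 1 → ∀ t, h.left (b1.right * t) = h.left t := by
    intro h h1 h3 t
    apply inv_y h2 h1
    apply α.injective
    simp only [map_mul, hb1, MulAut.apply_inv_self]
    exact base_comm h2 h3 hb
  have hN : ∀ a : P, a ≠ 1 → ∀ x, (α (sg a x)).right ≠ 1 := by
    intro a ha x h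
    have := hM _ rfl h x
    rw [sg_left_same, sg_left_ne] at this
    · exact ha this.symm
    · simpa using hy
  have hP : ∀ a c : P, a ≠ 1 → c ≠ 1 → ∀ (x z t : Q), (sg a x * (sg c z)⁻¹ : P ≀ᵣ Q).left (b1.right * t) =
      (sg a x * (sg c z)⁻¹ : P ≀ᵣ Q).left t := by
    intro a c ha hc x z
    apply hM
    · simp
    · have := uniq_y h2 α ha (b := sg a x) (c := sg c z) rfl rfl (hN a ha x) (hN c hc z)
      simp [this]
  refine ⟨b1.right, hy, ?_, ?_⟩
  · intro x
    by_contra! hx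
    by_cases h : ∃ a : P, a ≠ 1
    · obtain ⟨a, ha⟩ := h
      have := hP a a ha ha 1 x 1
      simp [sg_left_ne a 1 b1.right hy, sg_left_ne a x 1 hx.1.symm, sg_left_ne a x b1.right hx.2.symm] at this
      exact ha this.symm
    · push Not at h
      exact hy (by rw [hb1]; simp [show b = 1 by ext <;> simp [h, hb]])
  · intro a c ha hc
    have := hP a c ha hc 1 1 1
    simp [sg_left_ne _ 1 b1.right hy] at this
    exact (mul_inv_eq_one.mp this.symm)

lemma inS (α : MulAut (P ≀ᵣ Q)) {y : Q} (hQ : ∀ x : Q, x = 1 ∨ x = y) (hα : ¬ Pres α)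
    (g : P ≀ᵣ Q) (hg : g.right = 1) : (α g).left y = (α g).left 1 := by
  unfold Pres at hα
  push Not at hα
  obtain ⟨b, hb, hb'⟩ := hα
  rcases hQ (α g).right with h | h
  · have := inv_y h2 (w := α g) (b := α b) h (by rw [← map_mul, base_comm h2 hg hb, map_mul]) 1
    rw [(hQ (α b).right).resolve_left hb'] at this
    simpa using this
  · have h3 : g * g = 1 := by ext <;> simp [hg, h2]
    have h4 : α g * α g = 1 := by rw [← map_mul, h3, map_one]
    have := congrArg (fun g => g.left y) h4
    simp [h] at this
    have h5 := h2 ((α g).left 1)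
    exact mul_right_cancel (this.trans h5.symm)

lemma base_of_exp2 [Finite P] [Finite Q] [Nontrivial P] (α : MulAut (P ≀ᵣ Q)) (n : ℕ)
    (hn : α ^ (2 * n + 1) = 1) : Pres α := by
  classical
  by_contra hα
  obtain ⟨y, hy, hQ, hP⟩ := small h2 α hα
  obtain ⟨a, ha⟩ := exists_ne (1 : P)
  have hα2 : ¬ Pres (α ^ 2) := by
    intro h
    apply hα
    have h' := h.pow (n + 1)
    rw [← pow_mul] at h'
    have : 2 * (n + 1) = (2 * n + 1) + 1 := by ring
    rw [this, pow_succ, hn, one_mul] at h'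
    exact h'
  let B : Set (P ≀ᵣ Q) := {g | g.right = 1}
  let S : Set (P ≀ᵣ Q) := {g | g.left y = g.left 1}
  have hSB : S.ncard ≤ B.ncard := by
    apply Set.ncard_le_ncard_of_injOn (fun g : P ≀ᵣ Q => (⟨fun t => if t = 1 then g.left 1 else
      if g.right = 1 then 1 else a, 1⟩ : P ≀ᵣ Q))
    · intro g _; rfl
    · intro g hg g' hg' h
      have e1 := congrFun (congrArg RegularWreathProduct.left h) 1
      have e2 := congrFun (congrArg RegularWreathProduct.left h) y
      simp [hy] at e1 e2
      have hg : g.left y = g.left 1 := hg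
      have hg' : g'.left y = g'.left 1 := hg'
      ext t
      · rcases hQ t with rfl | rfl
        · exact e1
        · rw [hg, hg', e1]
      · rcases hQ g.right with h1 | h1 <;> rcases hQ g'.right with h2 | h2 <;>
          simp [h1, h2, hy] at e2 ⊢
        · exact absurd e2.symm ha
        · exact absurd e2 ha
  have key : ∀ β : MulAut (P ≀ᵣ Q), ¬ Pres β → β '' B = S := by
    intro β hβ
    apply Set.eq_of_subset_of_ncard_le
    · rintro _ ⟨g, hg, rfl⟩
      exact inS h2 β hQ hβ g hg
    · rw [Set.ncard_image_of_injective _ β.injective]; exact hSB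
    · exact Set.toFinite _
  apply hα
  intro b hb
  have h1 := key α hα
  have h3 := key _ hα2
  have : α (α b) ∈ α '' B := by
    rw [h1, ← h3]
    exact ⟨b, hb, by simp [pow_two]⟩
  obtain ⟨c, hc, e⟩ := this
  rw [← α.injective e]; exact hc
end exp2

lemma dvd_of_end {X : Type*} [Group X] [Finite X] {q : ℕ} (hqp : q.Prime) (e : X →* X)
    (hq : ∀ x, e^[q] x = x) (hne : ∃ x, e x ≠ x) : q ∣ Nat.card (MulAut X) := by
  have hinj : Function.Injective e := by
    have h : Function.Injective (e^[q]) := by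
      intro x y h; rwa [hq, hq] at h
    obtain ⟨n, rfl⟩ := Nat.exists_eq_succ_of_ne_zero hqp.ne_zero
    rw [Function.iterate_succ] at h
    exact h.of_comp
  let φ : MulAut X := MulEquiv.ofBijective e ⟨hinj, Finite.surjective_of_injective hinj⟩
  have hpow : ∀ n x, (φ ^ n) x = e^[n] x := by
    intro n
    induction n with
    | zero => simp
    | succ n ih => intro x; rw [pow_succ, MulAut.mul_apply, ih, Function.iterate_succ_apply]; rfl
  have : Fact q.Prime := ⟨hqp⟩
  have ho : orderOf φ = q := by
    apply orderOf_eq_prime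
    · ext x; rw [hpow, hq]; rfl
    · obtain ⟨x, hx⟩ := hne
      intro h
      apply hx
      have := DFunLike.congr_fun h x
      exact this
  rw [← ho]; exact orderOf_dvd_natCard φ

/-- sections -/
abbrev Sec (P Q : Type*) [Group P] [Group Q] := {s : Q →* P ≀ᵣ Q // ∀ y, (s y).right = y}

/-- base element -/
def bs (h : Q → P) : P ≀ᵣ Q := ⟨h, 1⟩

lemma sec_eq (s : Sec P Q) (y x : Q) :
    (s.1 y).left x = (s.1 x).left x * ((s.1 (y⁻¹ * x)).left (y⁻¹ * x))⁻¹ := by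
  have := congrArg (fun g => g.left x) (s.1.map_mul y (y⁻¹ * x))
  simp [-map_mul, s.2] at this
  exact eq_mul_inv_of_mul_eq this.symm

lemma sec_conj (s : Sec P Q) (y : Q) :
    s.1 y = bs (fun x => (s.1 x).left x) * inl y * (bs (fun x => (s.1 x).left x))⁻¹ := by
  ext x
  · rw [sec_eq]; simp [bs]
  · simp [s.2, bs]

lemma card_sec [Finite P] [Finite Q] :
    Nat.card (Sec P Q) * Nat.card P = Nat.card P ^ Nat.card Q := by
  rw [← Nat.card_prod, ← Nat.card_fun]
  apply Nat.card_eq_of_bijective (fun sc : Sec P Q × P => fun x => (sc.1.1 x).left x * sc.2)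
  constructor
  · rintro ⟨s, c⟩ ⟨s', c'⟩ h
    have h' := fun x => congrFun h x
    simp only at h'
    have hc : c = c' := by simpa using h' 1
    subst hc
    have hs : s = s' := by
      apply Subtype.ext
      ext y x
      · rw [sec_eq s, sec_eq s', mul_right_cancel (h' x), mul_right_cancel (h' (y⁻¹ * x))]
      · rw [s.2, s'.2]
    rw [hs]
  · intro h
    refine ⟨⟨⟨(MulAut.conj (bs h)).toMonoidHom.comp inl, fun y => by simp [bs]⟩, h 1⟩, ?_⟩
    funext x
    simp [bs]

lemma isPGroup {p : ℕ} [Fact p.Prime] [Finite P] [Finite Q] (hP : IsPGroup p P) (hQ : IsPGroup p Q) :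
    IsPGroup p (P ≀ᵣ Q) := by
  obtain ⟨m, hm⟩ := IsPGroup.iff_card.mp hP
  obtain ⟨n, hn⟩ := IsPGroup.iff_card.mp hQ
  apply IsPGroup.of_card (n := m * p ^ n + n)
  rw [RegularWreathProduct.card, hm, hn, ← pow_mul, ← pow_add]

lemma exists_fixed_sec {p q : ℕ} [Fact p.Prime] [Finite P] [Finite Q] (hP : IsPGroup p P)
    (hqp : q.Prime) (hne : q ≠ p) (α : MulAut (P ≀ᵣ Q)) (hα : α ^ q = 1)
    (hr : ∀ g, (α g).right = g.right) : ∃ s : Sec P Q, ∀ y, α (s.1 y) = s.1 y := by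
  classical
  have : Fact q.Prime := ⟨hqp⟩
  have : Finite (Sec P Q) := by
    have : Finite (Q →* P ≀ᵣ Q) := DFunLike.finite _
    infer_instance
  have := Fintype.ofFinite (Sec P Q)
  let f : Sec P Q → Sec P Q := fun s => ⟨α.toMonoidHom.comp s.1, fun y => by simp [hr, s.2]⟩
  have hf : ∀ n s y, (f^[n] s).1 y = (α ^ n) (s.1 y) := by
    intro n
    induction n with
    | zero => simp
    | succ n ih => intro s y; rw [Function.iterate_succ_apply, ih, pow_succ]; rfl
  have hfq : f^[q ^ 1] = id := by
    funext s
    apply Subtype.ext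
    ext1 y
    rw [hf, pow_one, hα]; rfl
  have hmod := Equiv.Perm.card_fixedPoints_modEq (f := f) (p := q) (n := 1) hfq
  have hnd : ¬ q ∣ Nat.card (Sec P Q) := by
    intro h
    have h' := (h.trans (dvd_mul_right _ (Nat.card P))).trans (card_sec (P := P) (Q := Q)).dvd
    obtain ⟨m, hm⟩ := IsPGroup.iff_card.mp hP
    rw [hm] at h'
    have := hqp.dvd_of_dvd_pow (hqp.dvd_of_dvd_pow h')
    exact hne ((Nat.prime_dvd_prime_iff_eq hqp Fact.out).mp this)
  by_contra! hcon
  have hempty : IsEmpty (Function.fixedPoints f) := by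
    refine ⟨fun ⟨s, hs⟩ => ?_⟩
    obtain ⟨y, hy⟩ := hcon s
    apply hy
    have := congrArg (fun s : Sec P Q => s.1 y) hs
    exact this
  rw [Fintype.card_eq_zero (α := Function.fixedPoints f), Nat.modEq_zero_iff_dvd, ← Nat.card_eq_fintype_card] at hmod
  exact hnd hmod

lemma thompson {p q : ℕ} [Fact p.Prime] {G : Type*} [Group G] [Finite G] (hG : IsPGroup p G)
    (hqp : q.Prime) (hne : q ≠ p) (β : MulAut G) (hβ : β ^ q = 1) (H : Set G)
    (hH : ∀ h ∈ H, β h = h) (hC : ∀ g, (∀ h ∈ H, g * h = h * g) → β g = g) : β = 1 := by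
  let C : Subgroup G := 
    { carrier := {g | β g = g}
      mul_mem' := fun {a b} (ha : β a = a) (hb : β b = b) => by
        show β (a * b) = a * b
        rw [map_mul, ha, hb]
      one_mem' := map_one β
      inv_mem' := fun {a} (ha : β a = a) => by
        show β a⁻¹ = a⁻¹
        rw [map_inv, ha] }
  have hmem : ∀ g, g ∈ C ↔ β g = g := fun g => Iff.rfl
  have : Group.IsNilpotent G := hG.isNilpotent
  have hn := normalizerCondition_iff_only_full_group_self_normalizing.mp
    (Group.normalizerCondition_of_isNilpotent (G := G)) C
  have htop : C = ⊤ := by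
    apply hn
    apply le_antisymm _ Subgroup.le_normalizer
    intro n hnn
    rw [Subgroup.mem_normalizer_iff] at hnn
    set d := n⁻¹ * β n with hd
    have hdC : β d = d := by
      apply hC
      intro h hh
      have h1 := (hmem _).mp ((hnn h).mp (hH h hh))
      simp only [map_mul, map_inv, hH h hh] at h1
      have h2 : β n * h = n * h * n⁻¹ * β n := by rw [← h1]; group
      rw [hd, mul_assoc, h2]; group
    have hbn : β n = n * d := by simp [hd]
    have hpow : ∀ k : ℕ, (β ^ k) n = n * d ^ k := by
      intro k
      induction k with
      | zero => simp
      | succ k ih => rw [pow_succ', MulAut.mul_apply, ih, map_mul, map_pow, hdC, hbn, pow_succ', mul_assoc]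
    have hdq : d ^ q = 1 := by
      have := hpow q
      rw [hβ] at this
      simpa using this
    have hd1 : d = 1 := by
      obtain ⟨k, hk⟩ := hG d
      have h1 := orderOf_dvd_of_pow_eq_one hdq
      have h2 := orderOf_dvd_of_pow_eq_one hk
      have hco : Nat.Coprime q (p ^ k) :=
        Nat.Coprime.pow_right _ ((Nat.coprime_primes hqp Fact.out).mpr hne)
      exact orderOf_eq_one_iff.mp (Nat.eq_one_of_dvd_coprimes hco h1 h2)
    rw [hmem, hbn, hd1, mul_one]
  ext g
  have : g ∈ C := htop ▸ Subgroup.mem_top g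
  exact this

/-- diagonal -/
def dg (a : P) : P ≀ᵣ Q := ⟨fun _ => a, 1⟩

lemma eq_dg {g : P ≀ᵣ Q} (hg : g.right = 1) (h : ∀ y, g * inl y = inl y * g) : g = dg (g.left 1) := by
  ext x
  · have := comm_base hg (h x) x
    simpa [dg] using this
  · exact hg

lemma pow_apply {X : Type*} [Group X] (β : MulAut X) (n : ℕ) (x : X) : (β ^ n) x = β^[n] x := by
  induction n generalizing x with
  | zero => simp
  | succ n ih => rw [pow_succ, MulAut.mul_apply, ih, Function.iterate_succ_apply]

lemma diag_case {p q : ℕ} [Fact p.Prime] [Finite P] [Finite Q] (hP : IsPGroup p P) (hQ : IsPGroup p Q)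
    (hqp : q.Prime) (hne : q ≠ p) (β : MulAut (P ≀ᵣ Q)) (hβ : β ^ q = 1) (h1 : β ≠ 1)
    (hr : ∀ g, (β g).right = g.right) (hi : ∀ y, β (inl y) = inl y) :
    q ∣ Nat.card (MulAut P) := by
  have hd : ∀ a : P, β (dg a) = dg ((β (dg a)).left 1) := by
    intro a
    apply eq_dg
    · rw [hr]; rfl
    · intro y
      conv_lhs => rw [← hi y]
      conv_rhs => rw [← hi y]
      rw [← map_mul, ← map_mul]
      congr 1
      ext <;> simp [dg]
  let e : P →* P :=
    { toFun := fun a => (β (dg a)).left 1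
      map_one' := by
        have : (dg 1 : P ≀ᵣ Q) = 1 := rfl
        rw [this, map_one]; rfl
      map_mul' := fun a b => by
        have : (dg (a * b) : P ≀ᵣ Q) = dg a * dg b := by ext <;> simp [dg]
        rw [this, map_mul, hd a]; simp [dg] }
  have hs : Function.Semiconj (dg : P → P ≀ᵣ Q) e β := fun a => (hd a).symm
  apply dvd_of_end hqp e
  · intro a
    have := (hs.iterate_right q) a
    rw [← pow_apply, hβ] at this
    exact congrFun (congrArg RegularWreathProduct.left this) 1
  · by_contra! hcon
    apply h1
    apply thompson (isPGroup hP hQ) hqp hne β hβ (Set.range (inl : Q → P ≀ᵣ Q))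
    · rintro _ ⟨y, rfl⟩; exact hi y
    · intro g hg
      have hg' : ∀ y, g * inl y = inl y * g := fun y => hg _ ⟨y, rfl⟩
      have hgd : g = bs g.left * inl g.right := by ext <;> simp [bs]
      have hb : (bs g.left : P ≀ᵣ Q) = dg (g.left 1) := by
        apply eq_dg rfl
        intro y
        have := hg' y
        ext x
        · have := congrArg (fun g => g.left x) this
          simpa [bs] using this
        · simp [bs]
      rw [hgd, map_mul, hi, hb, hd]
      congr 2
      exact hcon _

lemma main_dvd {p q : ℕ} [Fact p.Prime] [Finite P] [Finite Q] (hP : IsPGroup p P) (hQ : IsPGroup p Q)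
    (hqp : q.Prime) (hne : q ≠ p) (α : MulAut (P ≀ᵣ Q)) (hα : α ^ q = 1) (h1 : α ≠ 1)
    (hpr : Pres α) : q ∣ Nat.card (MulAut P) ∨ q ∣ Nat.card (MulAut Q) := by
  let e : Q →* Q := rightHom.comp (α.toMonoidHom.comp inl)
  have he : Function.Semiconj (RegularWreathProduct.right : P ≀ᵣ Q → Q) α e := by
    intro g
    have hgd : g = bs g.left * inl g.right := by ext <;> simp [bs]
    conv_lhs => rw [hgd, map_mul, mul_right, hpr _ rfl, one_mul]
    rfl
  by_cases h : ∃ y, e y ≠ y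
  · right
    apply dvd_of_end hqp e _ h
    intro y
    have := (he.iterate_right q) (inl y)
    rw [← pow_apply, hα] at this
    exact this.symm
  · left
    push Not at h
    have hr : ∀ g, (α g).right = g.right := fun g => (he g).trans (h _)
    obtain ⟨s, hs⟩ := exists_fixed_sec hP hqp hne α hα hr
    set b : P ≀ᵣ Q := bs (fun x => (s.1 x).left x) with hb
    set β := (MulAut.conj b)⁻¹ * α * (MulAut.conj b) with hβ
    have hβ' : β = (MulAut.conj b)⁻¹ * α * ((MulAut.conj b)⁻¹)⁻¹ := by rw [inv_inv]
    apply diag_case hP hQ hqp hne β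
    · rw [hβ', conj_pow, hα]; simp
    · intro h
      apply h1
      rw [hβ'] at h
      exact conj_eq_one_iff.mp h
    · intro g
      simp [hβ, hr, hb, bs]
    · intro y
      have : β (inl y) = (MulAut.conj b)⁻¹ (α (b * inl y * b⁻¹)) := rfl
      rw [this, ← sec_conj, hs, sec_conj]
      simp [← hb, mul_assoc]

lemma two_of_exp {p : ℕ} [Fact p.Prime] [Nontrivial P] (hP : IsPGroup p P) (h2 : ∀ a : P, a * a = 1) :
    p = 2 := by
  obtain ⟨a, ha⟩ := exists_ne (1 : P)
  have h : orderOf a = 2 := orderOf_eq_prime (by rw [pow_two, h2]) ha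
  obtain ⟨k, hk⟩ := hP a
  have := orderOf_dvd_of_pow_eq_one hk
  rw [h] at this
  exact ((Nat.prime_dvd_prime_iff_eq Nat.prime_two Fact.out).mp (Nat.prime_two.dvd_of_dvd_pow this)).symm

lemma main1 {p q : ℕ} [Fact p.Prime] [Finite P] [Finite Q] [Nontrivial P]
    (hP : IsPGroup p P) (hQ : IsPGroup p Q)
    (hqp : q.Prime) (hne : q ≠ p) (hq : q ∣ Nat.card (MulAut (P ≀ᵣ Q))) :
    q ∣ Nat.card (MulAut P) ∨ q ∣ Nat.card (MulAut Q) := by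
  have : Fact q.Prime := ⟨hqp⟩
  obtain ⟨α, hα⟩ := exists_prime_orderOf_dvd_card' q hq
  have hαq : α ^ q = 1 := by rw [← hα]; exact pow_orderOf_eq_one α
  have h1 : α ≠ 1 := by
    rintro rfl
    rw [orderOf_one] at hα
    exact hqp.one_lt.ne hα
  apply main_dvd hP hQ hqp hne α hαq h1
  by_cases h : ∃ a : P, a * a ≠ 1
  · exact fun b hb => base_of_ne hP h α b hb
  · push Not at h
    have hp := two_of_exp hP h
    obtain ⟨n, hn⟩ := hqp.odd_of_ne_two (hp ▸ hne)
    exact base_of_exp2 h α n (hn ▸ hαq)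

lemma dvd1 [Finite P] [Finite Q] : Nat.card (MulAut P) ∣ Nat.card (MulAut (P ≀ᵣ Q)) := by
  let f : MulAut P →* MulAut (P ≀ᵣ Q) :=
    { toFun := fun φ => RegularWreathProduct.congr φ (MulEquiv.refl Q)
      map_one' := rfl
      map_mul' := fun _ _ => rfl }
  apply Subgroup.card_dvd_of_injective f
  intro φ ψ h
  ext a
  have := DFunLike.congr_fun h (dg a)
  exact congrFun (congrArg RegularWreathProduct.left this) 1

lemma dvd2 [Finite P] [Finite Q] : Nat.card (MulAut Q) ∣ Nat.card (MulAut (P ≀ᵣ Q)) := by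
  let f : MulAut Q →* MulAut (P ≀ᵣ Q) :=
    { toFun := fun φ => RegularWreathProduct.congr (MulEquiv.refl P) φ
      map_one' := rfl
      map_mul' := fun _ _ => rfl }
  apply Subgroup.card_dvd_of_injective f
  intro φ ψ h
  ext a
  have := DFunLike.congr_fun h (inl a)
  exact congrArg RegularWreathProduct.right this

lemma dvd3 {p : ℕ} [Fact p.Prime] [Finite P] [Finite Q] [Nontrivial P] [Nontrivial Q]
    (hP : IsPGroup p P) (hQ : IsPGroup p Q) : p ∣ Nat.card (MulAut (P ≀ᵣ Q)) := by
  obtain ⟨a, ha⟩ := exists_ne (1 : P)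
  obtain ⟨y, hy⟩ := exists_ne (1 : Q)
  set c : MulAut (P ≀ᵣ Q) := MulAut.conj (inl y) with hc
  have hc1 : c ≠ 1 := by
    intro h
    have := congrFun (congrArg RegularWreathProduct.left (DFunLike.congr_fun h (sg a 1))) y
    simp [hc, sg_left_ne a 1 y hy] at this
    exact ha this
  obtain ⟨k, hk⟩ := (isPGroup hP hQ) (inl y)
  have h : c ^ p ^ k = 1 := by rw [hc, ← map_pow, hk, map_one]
  obtain ⟨m, -, hm⟩ := (Nat.dvd_prime_pow Fact.out).mp (orderOf_dvd_of_pow_eq_one h)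
  refine dvd_trans ?_ (orderOf_dvd_natCard c)
  rw [hm]
  apply dvd_pow_self
  rintro rfl
  exact hc1 (orderOf_eq_one_iff.mp (by simpa using hm))

end Hor

/-- Horoševskiĭ: for nontrivial finite `p`-groups `P₁`, `P₂`, the primes dividing
`|Aut (P₁ ≀ P₂)|` are exactly the primes dividing `|Aut P₁|` or `|Aut P₂|`, together
with `p`. -/
theorem primeFactors_card_aut_wreath (p : ℕ) [Fact p.Prime]
    (P₁ P₂ : Type*) [Group P₁] [Group P₂] [Finite P₁] [Finite P₂]
    (h₁ : IsPGroup p P₁) (h₂ : IsPGroup p P₂)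
    (h₁' : Nontrivial P₁) (h₂' : Nontrivial P₂) :
    (Nat.card (MulAut (WreathProduct P₁ P₂))).primeFactors =
      (Nat.card (MulAut P₁)).primeFactors ∪ (Nat.card (MulAut P₂)).primeFactors ∪ {p} := by
  let E : WreathProduct P₁ P₂ ≃* RegularWreathProduct P₁ P₂ :=
    { toFun := fun g => ⟨SemidirectProduct.left g, SemidirectProduct.right g⟩
      invFun := fun g => SemidirectProduct.mk g.left g.right
      left_inv := fun _ => rfl
      right_inv := fun _ => rfl
      map_mul' := fun _ _ => rfl }
  rw [Nat.card_congr (MulAut.congr E).toEquiv]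
  have hp : p.Prime := Fact.out
  ext q
  simp only [Finset.mem_union, Finset.mem_singleton, Nat.mem_primeFactors]
  have c0 : Nat.card (MulAut (RegularWreathProduct P₁ P₂)) ≠ 0 := Nat.card_pos.ne'
  have c1 : Nat.card (MulAut P₁) ≠ 0 := Nat.card_pos.ne'
  have c2 : Nat.card (MulAut P₂) ≠ 0 := Nat.card_pos.ne'
  constructor
  · rintro ⟨hq, hd, -⟩
    by_cases h : q = p
    · exact Or.inr h
    · rcases Hor.main1 h₁ h₂ hq h hd with h | h
      · exact Or.inl (Or.inl ⟨hq, h, c1⟩)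
      · exact Or.inl (Or.inr ⟨hq, h, c2⟩)
  · rintro ((⟨hq, hd, -⟩ | ⟨hq, hd, -⟩) | rfl)
    · exact ⟨hq, hd.trans Hor.dvd1, c0⟩
    · exact ⟨hq, hd.trans Hor.dvd2, c0⟩
    · exact ⟨hp, Hor.dvd3 h₁ h₂, c0⟩
end

section
/- Let G be a finite abelian p-group of type λ (i.e., G ≅ ⊕_i C_{p^{λ_i}} with λ₁ ≥ λ₂ ≥ ⋯). Then |Aut(G)| = p^(|λ| + 2n(λ)) · ∏_{i≥1} φ_{m_i(λ)}(p⁻¹), where m_i(λ) is the number of parts of λ equal to i, n(λ) = Σ_i binom(λ'_i, 2) with λ' the conjugate partition, |λ| = Σ_i λ_i, and φ_m(t) = (1−t)(1−t²)⋯(1−t^m). -/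
section Aux
open Finset

lemma aux_exp {k : ℕ} (lam : Fin k → ℕ) :
    ∑ i, ∑ j, min (lam j) (lam i) = (∑ i, lam i) +
          2 * ∑ j ∈ Icc 1 (∑ i, lam i), Nat.choose (univ.filter fun i => j ≤ lam i).card 2 := by
  set N := ∑ i, lam i with hN
  have hle : ∀ i, lam i ≤ N := fun i => Finset.single_le_sum (f := lam) (fun _ _ => Nat.zero_le _) (mem_univ i)
  have h1 : ∀ a, a ≤ N → a = ∑ l ∈ Icc 1 N, if l ≤ a then 1 else 0 := by
    intro a ha
    rw [Finset.sum_boole]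
    have : (Icc 1 N).filter (fun l => l ≤ a) = Icc 1 a := by
      ext x; simp; omega
    rw [this]; simp
  have hc : ∀ l, (univ.filter fun i => l ≤ lam i).card = ∑ i, if l ≤ lam i then 1 else 0 := by
    intro l; rw [Finset.sum_boole]; simp
  have h2 : N = ∑ l ∈ Icc 1 N, (univ.filter fun i => l ≤ lam i).card := by
    simp_rw [hc]
    rw [Finset.sum_comm]
    conv_lhs => rw [hN]
    exact Finset.sum_congr rfl fun i _ => h1 _ (hle i)
  have h3 : ∑ i, ∑ j, min (lam j) (lam i)
      = ∑ l ∈ Icc 1 N, (univ.filter fun i => l ≤ lam i).card ^ 2 := by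
    simp_rw [hc, sq, Finset.sum_mul_sum]
    symm
    rw [Finset.sum_comm]
    refine Finset.sum_congr rfl fun i _ => ?_
    rw [Finset.sum_comm]
    refine Finset.sum_congr rfl fun j _ => ?_
    symm
    rw [h1 (min (lam j) (lam i)) ((min_le_left _ _).trans (hle j))]
    refine Finset.sum_congr rfl fun l _ => ?_
    by_cases ha : l ≤ lam i <;> by_cases hb : l ≤ lam j <;> simp [ha, hb]
  rw [h3, Finset.mul_sum]
  refine Eq.trans ?_ (congrArg (· + _) h2.symm)
  rw [← Finset.sum_add_distrib]
  refine Finset.sum_congr rfl fun l _ => ?_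
  generalize (univ.filter fun i => l ≤ lam i).card = c
  induction c with
  | zero => simp
  | succ c ih => rw [Nat.choose_succ_succ' c 1, Nat.choose_one_right]; nlinarith

lemma aux_bounds {k : ℕ} (lam : Fin k → ℕ) (hmono : Antitone lam) (i : Fin k) :
    (i : ℕ) < (univ.filter fun j => lam i ≤ lam j).card ∧
    (univ.filter fun j => lam i ≤ lam j).card ≤ i + (univ.filter fun j => lam j = lam i).card := by
  constructor
  · have : Iic i ⊆ univ.filter fun j => lam i ≤ lam j := by
      intro j hj; simp at hj ⊢; exact hmono hj
    have := card_le_card this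
    simp at this; omega
  · have : (univ.filter fun j => lam i ≤ lam j) ⊆ Iio i ∪ univ.filter fun j => lam j = lam i := by
      intro j hj
      simp at hj ⊢
      by_cases h : j < i
      · exact Or.inl h
      · exact Or.inr (le_antisymm (hmono (not_lt.1 h)) hj)
    have := (card_le_card this).trans (card_union_le _ _)
    simpa using this

lemma aux_prod {k : ℕ} (lam : Fin k → ℕ) (hpos : ∀ i, 0 < lam i) (hmono : Antitone lam) (q : ℚ) :
    ∏ i : Fin k, (1 - q ^ ((univ.filter fun j => lam i ≤ lam j).card - (i : ℕ))) =
    ∏ j ∈ Icc 1 (∑ i, lam i),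
          ∏ t ∈ Icc 1 (univ.filter fun i => lam i = j).card, (1 - q ^ t) := by
  rw [← Finset.prod_fiberwise_of_maps_to (s := univ) (t := Icc 1 (∑ i, lam i)) (g := lam)]
  · refine Finset.prod_congr rfl fun l _ => ?_
    set c := (univ.filter fun j => l ≤ lam j).card with hc
    have hb : ∀ i ∈ univ.filter (fun i => lam i = l),
        (i : ℕ) < c ∧ c ≤ i + (univ.filter fun j => lam j = l).card := by
      intro i hi
      simp at hi
      have := aux_bounds lam hmono i
      simpa [hi, hc] using this
    have himg : (univ.filter (fun i => lam i = l)).image (fun i : Fin k => c - (i : ℕ)) =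
        Icc 1 (univ.filter fun i => lam i = l).card := by
      apply Finset.eq_of_subset_of_card_le
      · intro x hx
        simp only [mem_image] at hx
        obtain ⟨i, hi, rfl⟩ := hx
        have := hb i hi
        simp only [mem_Icc]
        omega
      · rw [Finset.card_image_of_injOn]
        · simp
        · intro i hi j hj hij
          have h1 := hb i hi
          have h2 := hb j hj
          simp only at hij
          apply Fin.ext
          omega
    rw [← himg, Finset.prod_image]
    · refine Finset.prod_congr rfl fun i hi => ?_
      simp only [mem_filter] at hi
      rw [hi.2]
    · intro i hi j hj hij
      have h1 := hb i hi
      have h2 := hb j hj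
      simp only at hij
      apply Fin.ext
      omega
  · intro i _
    simp only [mem_Icc]
    exact ⟨hpos i, Finset.single_le_sum (f := lam) (fun _ _ => Nat.zero_le _) (mem_univ i)⟩

lemma aux_min {k : ℕ} (lam : Fin k → ℕ) (l : ℕ) (hl : 0 < l) :
    ∑ j, min (lam j) l = ∑ j, min (lam j) (l - 1) + (univ.filter fun j => l ≤ lam j).card := by
  rw [card_filter, ← Finset.sum_add_distrib]
  refine Finset.sum_congr rfl fun j _ => ?_
  split_ifs <;> omega

lemma aux_final (p : ℕ) [Fact p.Prime] {k : ℕ} (lam : Fin k → ℕ) (hpos : ∀ i, 0 < lam i)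
    (hmono : Antitone lam) :
    ∏ i : Fin k, ((p : ℚ) ^ (∑ j, min (lam j) (lam i)) - (p : ℚ) ^ (i : ℕ) *
       (p : ℚ) ^ (∑ j, min (lam j) (lam i - 1))) = 
      (p : ℚ) ^ ((∑ i, lam i) +
          2 * ∑ j ∈ Icc 1 (∑ i, lam i), Nat.choose (univ.filter fun i => j ≤ lam i).card 2) *
        ∏ j ∈ Icc 1 (∑ i, lam i),
          ∏ t ∈ Icc 1 (univ.filter fun i => lam i = j).card, (1 - (p : ℚ)⁻¹ ^ t) := by
  have hp : (p : ℚ) ≠ 0 := by exact_mod_cast (Fact.out : p.Prime).ne_zero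
  rw [← aux_exp, ← aux_prod lam hpos hmono, ← Finset.prod_pow_eq_pow_sum, ← Finset.prod_mul_distrib]
  refine Finset.prod_congr rfl fun i _ => ?_
  rw [aux_min lam (lam i) (hpos i), pow_add]
  obtain ⟨h, -⟩ := aux_bounds lam hmono i
  obtain ⟨d, hd⟩ := Nat.exists_eq_add_of_lt h
  rw [hd, show (i : ℕ) + d + 1 - i = d + 1 by omega, inv_pow, add_assoc, pow_add (p : ℚ) i]
  field_simp

lemma card_comap_aux {A V : Type*} [AddCommGroup A] [Finite A] [AddCommGroup V] (f : A →+ V)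
    (W : AddSubgroup V) (hW : W ≤ f.range) :
    Nat.card (W.comap f) = Nat.card W * Nat.card f.ker := by
  let g := f.comp (W.comap f).subtype
  have h1 : g.range = W := by
    ext v
    constructor
    · rintro ⟨⟨x, hx⟩, rfl⟩; exact hx
    · intro hv
      obtain ⟨x, rfl⟩ := hW hv
      exact ⟨⟨x, hv⟩, rfl⟩
  have h2 : Nat.card g.ker = Nat.card f.ker := by
    refine Nat.card_congr ⟨fun x => ⟨x.1.1, x.2⟩, fun x => ⟨⟨x.1, ?_⟩, x.2⟩, fun x => rfl, fun x => rfl⟩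
    have : f x.1 = 0 := x.2
    simp [this]
  rw [← g.ker.card_mul_index, AddSubgroup.index_ker, h1, h2, mul_comm]

lemma count_step {p : ℕ} [Fact p.Prime] {A V : Type*} [AddCommGroup A] [Finite A] [AddCommGroup V]
    [Module (ZMod p) V] [Finite V] (f : A →+ V) {n : ℕ} (s : Fin n → V)
    (hs : LinearIndependent (ZMod p) s) (hr : ∀ i, s i ∈ f.range) :
    (Nat.card {x : A // f x ∉ Submodule.span (ZMod p) (Set.range s)} : ℚ) =
      (Nat.card A : ℚ) - p ^ n * Nat.card f.ker := by
  classical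
  have := Fintype.ofFinite A
  set W := Submodule.span (ZMod p) (Set.range s) with hWdef
  have hcW : Nat.card W = p ^ n := by
    rw [Module.natCard_eq_pow_finrank (K := ZMod p), hWdef, finrank_span_eq_card hs]
    simp
  have hW : W.toAddSubgroup ≤ f.range := by
    have : W ≤ AddSubgroup.toZModSubmodule p f.range := by
      rw [hWdef, Submodule.span_le]
      rintro _ ⟨i, rfl⟩
      exact hr i
    exact this
  have h1 := card_comap_aux f W.toAddSubgroup hW
  have h2 : Nat.card W.toAddSubgroup = p ^ n := hcW
  have h3 : Nat.card {x : A // f x ∈ W} = p ^ n * Nat.card f.ker := by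
    rw [← h2, ← h1]; rfl
  have h4 : Nat.card {x : A // f x ∈ W} + Nat.card {x : A // f x ∉ W} = Nat.card A := by
    rw [← Nat.card_sum]
    exact Nat.card_congr (Equiv.sumCompl _)
  rw [← h4, h3]; push_cast; ring

lemma count_li {p : ℕ} [Fact p.Prime] {V : Type*} [AddCommGroup V]
    [Module (ZMod p) V] [Finite V] : ∀ (n : ℕ) (A : Fin n → Type*) [∀ i, AddCommGroup (A i)]
    [∀ i, Finite (A i)] (f : ∀ i, A i →+ V) (_ : ∀ i j, i ≤ j → (f i).range ≤ (f j).range),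
    (Nat.card {a : (∀ i, A i) // LinearIndependent (ZMod p) fun i => f i (a i)} : ℚ) =
      ∏ i, ((Nat.card (A i) : ℚ) - p ^ (i : ℕ) * Nat.card (f i).ker)
  | 0, A, _, _, f, _ => by
    have : Nat.card {a : (∀ i, A i) // LinearIndependent (ZMod p) fun i => f i (a i)} = 1 := by
      rw [Nat.card_eq_one_iff_unique]
      exact ⟨⟨fun a b => Subtype.ext (Subsingleton.elim _ _)⟩, ⟨⟨fun i => i.elim0, linearIndependent_empty_type⟩⟩⟩
    simp [this]
  | n + 1, A, _, _, f, hf => by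
    have ih := count_li (p := p) n (fun i => A i.castSucc) (fun i => f i.castSucc)
      (fun i j hij => hf _ _ (by simpa using hij))
    let φ : {a : (∀ i, A i) // LinearIndependent (ZMod p) fun i => f i (a i)} →
      Σ a : {a : (∀ i : Fin n, A i.castSucc) // LinearIndependent (ZMod p) fun i => f i.castSucc (a i)},
        {x : A (Fin.last n) // f _ x ∉ Submodule.span (ZMod p) (Set.range fun i => f i.castSucc (a.1 i))} :=
      fun a => ⟨⟨fun i => a.1 i.castSucc, (linearIndependent_finSucc'.1 a.2).1⟩,
          ⟨a.1 (Fin.last n), (linearIndependent_finSucc'.1 a.2).2⟩⟩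
    have hφ : Function.Bijective φ := by
      constructor
      · rintro ⟨a, ha⟩ ⟨b, hb⟩ h
        have h1 : (fun i : Fin n => a i.castSucc) = fun i : Fin n => b i.castSucc := congrArg (fun z => z.1.1) h
        have h2 : a (Fin.last n) = b (Fin.last n) := congrArg (fun z => z.2.1) h
        apply Subtype.ext
        funext i
        refine Fin.lastCases h2 (fun j => congrFun h1 j) i
      · rintro ⟨⟨a, ha⟩, ⟨x, hx⟩⟩
        obtain ⟨b, hb1, hb2⟩ : ∃ b : ∀ i, A i, (fun i : Fin n => b i.castSucc) = a ∧ b (Fin.last n) = x :=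
          ⟨Fin.snoc (α := A) a x, by funext i; simp, by simp⟩
        subst hb1 hb2
        exact ⟨⟨b, linearIndependent_finSucc'.2 ⟨ha, hx⟩⟩, rfl⟩
    let e := Equiv.ofBijective φ hφ
    have := Fintype.ofFinite {a : (∀ i : Fin n, A i.castSucc) // LinearIndependent (ZMod p) fun i => f i.castSucc (a i)}
    rw [Nat.card_congr e, Nat.card_sigma, Fin.prod_univ_castSucc]
    push_cast
    simp only [Fin.val_castSucc, Fin.val_last]
    rw [Finset.sum_congr rfl (fun a _ => count_step (f (Fin.last n)) _ a.2 
      (fun i => hf _ _ (Fin.le_last _) ⟨_, rfl⟩))]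
    rw [Finset.sum_const, nsmul_eq_mul, ← ih, Finset.card_univ, ← Nat.card_eq_fintype_card]

lemma card_tors (p : ℕ) [Fact p.Prime] {k : ℕ} (lam : Fin k → ℕ) (l : ℕ) :
    Nat.card (nsmulAddMonoidHom (α := Π i : Fin k, ZMod (p ^ lam i)) (p ^ l)).ker =
      p ^ (∑ j, min (lam j) l) := by
  have h : ∀ j, Nat.card (nsmulAddMonoidHom (α := ZMod (p ^ lam j)) (p ^ l)).ker = p ^ (min (lam j) l) := by
    intro j
    have : NeZero (p ^ lam j) := ⟨pow_ne_zero _ (Fact.out : p.Prime).ne_zero⟩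
    rw [IsAddCyclic.card_nsmulAddMonoidHom_ker, Nat.card_zmod]
    rcases le_total (lam j) l with h | h
    · rw [min_eq_left h, Nat.gcd_eq_left (pow_dvd_pow _ h)]
    · rw [min_eq_right h, Nat.gcd_eq_right (pow_dvd_pow _ h)]
  rw [← Finset.prod_pow_eq_pow_sum, ← Finset.prod_congr rfl (fun j _ => h j), ← Nat.card_pi]
  refine Nat.card_congr ⟨fun x i => ⟨x.1 i, congrFun x.2 i⟩, fun x => ⟨fun i => (x i).1, funext fun i => (x i).2⟩, fun x => rfl, fun x => rfl⟩

def homEquivFun {k : ℕ} (N : Fin k → ℕ) (M : Type*) [AddCommGroup M] (f : (Π i, ZMod (N i)) →+ M) :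
    Π i, (nsmulAddMonoidHom (α := M) (N i)).ker := fun i => ⟨f (Pi.single i 1), by
      rw [AddMonoidHom.mem_ker, nsmulAddMonoidHom_apply, ← map_nsmul, ← Pi.single_smul]
      simp⟩

lemma homEquiv_eval {k : ℕ} (N : Fin k → ℕ) {M : Type*} [AddCommGroup M]
    (f : (Π i, ZMod (N i)) →+ M) (c : Fin k → ℤ) :
    f (fun i => (c i : ZMod (N i))) = ∑ i, c i • (homEquivFun N M f i : M) := by
  simp only [homEquivFun, ← map_zsmul, ← map_sum]
  congr 1
  rw [← Finset.univ_sum_single (fun i => (c i : ZMod (N i)))]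
  refine Finset.sum_congr rfl fun i _ => ?_
  rw [← Pi.single_smul]
  simp

lemma homEquiv_bij {k : ℕ} (N : Fin k → ℕ) (M : Type*) [AddCommGroup M] :
    Function.Bijective (homEquivFun N M) := by
  constructor
  · intro f g h
    refine AddMonoidHom.ext fun x => ?_
    obtain ⟨c, rfl⟩ : ∃ c : Fin k → ℤ, (fun i => (c i : ZMod (N i))) = x :=
      ⟨fun i => (ZMod.intCast_surjective (x i)).choose, funext fun i => (ZMod.intCast_surjective (x i)).choose_spec⟩
    rw [homEquiv_eval, homEquiv_eval, h]
  · intro g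
    refine ⟨∑ i, (ZMod.lift (N i) ⟨zmultiplesHom M (g i : M), ?_⟩).comp (Pi.evalAddMonoidHom _ i), ?_⟩
    · have := (g i).2
      rw [AddMonoidHom.mem_ker, nsmulAddMonoidHom_apply] at this
      simpa using this
    · funext i
      apply Subtype.ext
      simp only [homEquivFun]
      rw [AddMonoidHom.finsetSum_apply, Finset.sum_eq_single i]
      · simp only [AddMonoidHom.comp_apply, Pi.evalAddMonoidHom_apply, Pi.single_eq_same]
        rw [← Int.cast_one, ZMod.lift_coe]
        simp
      · intro j _ hj
        simp [Pi.single_eq_of_ne hj]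
      · simp

lemma li_iff {p : ℕ} [Fact p.Prime] {V : Type*} [AddCommGroup V] [Module (ZMod p) V] {k : ℕ}
    (s : Fin k → V) : LinearIndependent (ZMod p) s ↔
      ∀ c : Fin k → ℤ, ∑ i, c i • s i = 0 → ∀ i, (p : ℤ) ∣ c i := by
  rw [Fintype.linearIndependent_iff]
  constructor
  · intro h c hc i
    rw [← ZMod.intCast_zmod_eq_zero_iff_dvd]
    refine h (fun i => (c i : ZMod p)) ?_ i
    simpa only [Int.cast_smul_eq_zsmul] using hc
  · intro h g hg i
    choose c hc using fun i => ZMod.intCast_surjective (g i)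
    rw [← hc, ZMod.intCast_zmod_eq_zero_iff_dvd]
    refine h c ?_ i
    rw [← hg]
    refine Finset.sum_congr rfl fun i _ => ?_
    rw [← hc, Int.cast_smul_eq_zsmul]

lemma inj_iff {p : ℕ} [Fact p.Prime] {k : ℕ} (lam : Fin k → ℕ) (hpos : ∀ i, 0 < lam i)
    {M : Type*} [AddCommGroup M] (f : (Π i, ZMod (p ^ lam i)) →+ M) :
    Function.Injective f ↔ ∀ c : Fin k → ℤ,
      ∑ i, c i • (p ^ (lam i - 1) • (homEquivFun _ M f i : M)) = 0 → ∀ i, (p : ℤ) ∣ c i := by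
  have hp : (p : ℤ) ≠ 0 := by exact_mod_cast (Fact.out : p.Prime).ne_zero
  have key : ∀ c : Fin k → ℤ, ∑ i, c i • (p ^ (lam i - 1) • (homEquivFun _ M f i : M)) =
      f (fun i => ((c i * (p : ℤ) ^ (lam i - 1) : ℤ) : ZMod (p ^ lam i))) := by
    intro c
    rw [homEquiv_eval]
    refine Finset.sum_congr rfl fun i _ => ?_
    rw [mul_smul, ← natCast_zsmul (_ : M) (p ^ (lam i - 1))]
    push_cast
    rfl
  have hpow : ∀ i, (p : ℤ) ^ lam i = p * (p : ℤ) ^ (lam i - 1) := by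
    intro i
    rw [← pow_succ', Nat.sub_add_cancel (hpos i)]
  have hdvd : ∀ i (c : ℤ), ((c * (p : ℤ) ^ (lam i - 1) : ℤ) : ZMod (p ^ lam i)) = 0 ↔ (p : ℤ) ∣ c := by
    intro i c
    rw [ZMod.intCast_zmod_eq_zero_iff_dvd]
    push_cast
    rw [hpow, mul_dvd_mul_iff_right (pow_ne_zero _ hp)]
  constructor
  · intro hf c hc i
    rw [key] at hc
    have := hf (hc.trans (map_zero f).symm)
    exact (hdvd i _).1 (congrFun this i)
  · intro h
    rw [injective_iff_map_eq_zero]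
    intro x hx
    by_contra hx0
    have hex : ∃ n, p ^ n • x = 0 := by
      refine ⟨∑ i, lam i, ?_⟩
      funext i
      have : lam i ≤ ∑ i, lam i := Finset.single_le_sum (f := lam) (fun _ _ => Nat.zero_le _) (mem_univ i)
      rw [Pi.smul_apply, Pi.zero_apply, nsmul_eq_mul]
      have h0 : ((p ^ (∑ i, lam i) : ℕ) : ZMod (p ^ lam i)) = 0 := by
        rw [ZMod.natCast_eq_zero_iff]
        exact pow_dvd_pow _ this
      rw [h0, zero_mul]
    classical
    obtain ⟨n, hn⟩ : ∃ n, Nat.find hex = n + 1 := by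
      apply Nat.exists_eq_succ_of_ne_zero
      intro h0
      have := Nat.find_spec hex
      rw [h0] at this
      simp at this
      exact hx0 this
    have h1 : p ^ (n + 1) • x = 0 := hn ▸ Nat.find_spec hex
    have h2 : p ^ n • x ≠ 0 := Nat.find_min hex (by omega)
    apply h2
    set y := p ^ n • x with hy
    have hfy : f y = 0 := by rw [hy, map_nsmul, hx, smul_zero]
    have hpy : p • y = 0 := by rw [hy, ← mul_smul, ← pow_succ', h1]
    have hc : ∀ i, ∃ c : ℤ, ((c * (p : ℤ) ^ (lam i - 1) : ℤ) : ZMod (p ^ lam i)) = y i := by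
      intro i
      obtain ⟨z, hz⟩ := ZMod.intCast_surjective (y i)
      have h3 : p • y i = 0 := congrFun hpy i
      rw [← hz, nsmul_eq_mul, ← Int.cast_natCast p, ← Int.cast_mul, ZMod.intCast_zmod_eq_zero_iff_dvd] at h3
      push_cast at h3
      rw [hpow, mul_dvd_mul_iff_left hp] at h3
      obtain ⟨c, rfl⟩ := h3
      exact ⟨c, by rw [← hz, mul_comm]⟩
    choose c hc using hc
    have h4 := h c (by rw [key]; simp_rw [hc]; exact hfy)
    funext i
    rw [← hc, (hdvd i _).2 (h4 i)]
    rfl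


lemma card_inj (p : ℕ) [Fact p.Prime] (k : ℕ) (lam : Fin k → ℕ) (hpos : ∀ i, 0 < lam i)
    (hmono : Antitone lam) :
    (Nat.card {f : (Π i : Fin k, ZMod (p ^ lam i)) →+ (Π i : Fin k, ZMod (p ^ lam i)) //
      Function.Injective f} : ℚ) =
    ∏ i : Fin k, ((p : ℚ) ^ (∑ j, min (lam j) (lam i)) - (p : ℚ) ^ (i : ℕ) *
       (p : ℚ) ^ (∑ j, min (lam j) (lam i - 1))) := by
  set P := Π i : Fin k, ZMod (p ^ lam i) with hP
  have : ∀ i, NeZero (p ^ lam i) := fun i => ⟨pow_ne_zero _ (Fact.out : p.Prime).ne_zero⟩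
  have : Finite P := by rw [hP]; infer_instance
  let V := (nsmulAddMonoidHom (α := P) p).ker
  letI : Module (ZMod p) V := AddCommGroup.zmodModule (fun x => Subtype.ext x.2)
  let A : Fin k → Type := fun i => (nsmulAddMonoidHom (α := P) (p ^ lam i)).ker
  letI : ∀ i, AddCommGroup (A i) := fun i =>
    inferInstanceAs (AddCommGroup (nsmulAddMonoidHom (α := P) (p ^ lam i)).ker)
  haveI : ∀ i, Finite (A i) := fun i =>
    inferInstanceAs (Finite (nsmulAddMonoidHom (α := P) (p ^ lam i)).ker)
  have hA : ∀ i (x : A i), p ^ lam i • x.1 = 0 := fun i x => x.2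
  let F : ∀ i, A i →+ V := fun i =>
    { toFun := fun x => ⟨p ^ (lam i - 1) • x.1, by
        rw [AddMonoidHom.mem_ker, nsmulAddMonoidHom_apply, ← mul_smul, ← pow_succ',
          Nat.sub_add_cancel (hpos i), hA]⟩
      map_zero' := Subtype.ext (smul_zero _)
      map_add' := fun x y => Subtype.ext (smul_add _ _ _) }
  have hF : ∀ i j, i ≤ j → (F i).range ≤ (F j).range := by
    rintro i j hij _ ⟨x, rfl⟩
    have hl := hmono hij
    refine ⟨⟨p ^ (lam i - lam j) • x.1, ?_⟩, Subtype.ext ?_⟩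
    · rw [AddMonoidHom.mem_ker, nsmulAddMonoidHom_apply, ← mul_smul, ← pow_add,
        Nat.add_sub_cancel' hl, hA]
    · change p ^ (lam j - 1) • (p ^ (lam i - lam j) • x.1) = p ^ (lam i - 1) • x.1
      rw [← mul_smul, ← pow_add]
      congr 2
      have := hpos j
      omega
  have hcount := count_li (p := p) k A F hF
  have hker : ∀ i, Nat.card (F i).ker = p ^ (∑ j, min (lam j) (lam i - 1)) := by
    intro i
    rw [← card_tors p lam (lam i - 1)]
    refine Nat.card_congr ⟨fun x => ⟨x.1.1, congrArg Subtype.val x.2⟩,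
      fun x => ⟨⟨x.1, ?_⟩, Subtype.ext x.2⟩, fun x => rfl, fun x => rfl⟩
    have : p ^ (lam i - 1) • x.1 = 0 := x.2
    rw [AddMonoidHom.mem_ker, nsmulAddMonoidHom_apply,
      show p ^ lam i = p * p ^ (lam i - 1) by rw [← pow_succ', Nat.sub_add_cancel (hpos i)],
      mul_smul, this, smul_zero]
  have hcA : ∀ i, Nat.card (A i) = p ^ (∑ j, min (lam j) (lam i)) := fun i => card_tors p lam (lam i)
  simp only [hker, hcA] at hcount
  push_cast at hcount
  rw [← hcount]
  congr 1
  refine Nat.card_congr (Equiv.subtypeEquiv (Equiv.ofBijective _ (homEquiv_bij _ P)) fun f => ?_)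
  rw [inj_iff lam hpos, li_iff]
  refine forall_congr' fun c => imp_congr_left ?_
  rw [← (AddSubgroup.subtype_injective V).eq_iff, map_sum, map_zero]
  rfl

end Aux

open Finset in
/-- Macdonald's formula: if `G` is a finite abelian `p`-group of type `λ` (so
`G ≅ ⊕ᵢ C_(p^λᵢ)` with `λ₁ ≥ λ₂ ≥ ⋯ ≥ 1`), then
`|Aut G| = p^(|λ| + 2n(λ)) · ∏_{j ≥ 1} φ_{m_j(λ)}(p⁻¹)`, where `m_j(λ)` is the number of
parts of `λ` equal to `j`, `n(λ) = Σ_j C(λ'_j, 2)` with `λ'` the conjugate partition, and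
`φ_m(t) = (1 - t)(1 - t²)⋯(1 - t^m)`. -/
theorem card_aut_abelian_pGroup (p : ℕ) [Fact p.Prime] (G : Type*) [AddCommGroup G] [Finite G]
    (k : ℕ) (lam : Fin k → ℕ) (hpos : ∀ i, 0 < lam i) (hmono : Antitone lam)
    (hiso : Nonempty (G ≃+ Π i : Fin k, ZMod (p ^ lam i))) :
    (Nat.card (AddAut G) : ℚ) =
      (p : ℚ) ^ ((∑ i, lam i) +
          2 * ∑ j ∈ Icc 1 (∑ i, lam i), Nat.choose (univ.filter fun i => j ≤ lam i).card 2) *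
        ∏ j ∈ Icc 1 (∑ i, lam i),
          ∏ t ∈ Icc 1 (univ.filter fun i => lam i = j).card, (1 - (p : ℚ)⁻¹ ^ t) := by
  obtain ⟨e⟩ := hiso
  rw [← aux_final p lam hpos hmono, ← card_inj p k lam hpos hmono]
  congr 1
  have : ∀ i, NeZero (p ^ lam i) := fun i => ⟨pow_ne_zero _ (Fact.out : p.Prime).ne_zero⟩
  refine Nat.card_congr
    { toFun := fun a => ⟨((e.symm.trans a).trans e : _ ≃+ _).toAddMonoidHom,
        ((e.symm.trans a).trans e).injective⟩
      invFun := fun f => (e.trans (AddEquiv.ofBijective f.1 (Finite.injective_iff_bijective.1 f.2))).trans e.symm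
      left_inv := fun a => by
        apply AddEquiv.ext
        intro x
        simp
      right_inv := fun f => by
        apply Subtype.ext
        apply AddMonoidHom.ext
        intro x
        simp }
end

section
/- For p odd, the group G = ⟨a, b : a^(p^n) = 1, b^(p^n) = a^(p^(n−1)), a^b = a^(1+p)⟩ with n ≥ 3 satisfies |Aut(G)| = p·|G|. -/
theorem men_num1 (p : ℕ) (hp : p.Prime) (h3 : 3 ≤ p) (m : ℕ) :
    ∃ y, (1 + p) ^ (p ^ m) = 1 + p ^ (m + 1) + p ^ (m + 2) * y := by
  obtain ⟨y, hy⟩ := ZMod.exists_one_add_mul_pow_prime_pow_eq (R := ℕ) (u := p) (v := p) hp dvd_rfl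
    (by have := pow_dvd_pow p h3
        simpa [pow_succ] using this) 1 m
  exact ⟨y, by simp only [mul_one, Nat.cast_id] at hy; rw [hy]; ring⟩

theorem men_num2 (p : ℕ) (hp : p.Prime) (h3 : 3 ≤ p) (m s : ℕ) :
    ∃ z, (1 + p) ^ (p ^ (m + 1) * s) = 1 + p ^ (m + 2) * s + p ^ (m + 3) * z := by
  obtain ⟨y, hy⟩ := men_num1 p hp h3 (m + 1)
  induction s with
  | zero => exact ⟨0, by simp⟩
  | succ s ih =>
    obtain ⟨z, hz⟩ := ih
    rw [mul_add, pow_add, hz, mul_one, hy]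
    refine ⟨y + p ^ (m + 1) * s + p ^ (m + 2) * s * y + z * (1 + p ^ (m + 2) + p ^ (m + 3) * y), ?_⟩
    ring

theorem men_num3 (p q k : ℕ) (hq : q ≡ 1 [MOD p]) :
    p ^ k ∣ ∑ r ∈ Finset.range (p ^ k), q ^ r := by
  induction k with
  | zero => simp
  | succ k ih =>
    have h : ∀ t, ∑ r ∈ Finset.range (p ^ k * t), q ^ r
        = (∑ r ∈ Finset.range (p ^ k), q ^ r) * ∑ r ∈ Finset.range t, (q ^ p ^ k) ^ r := by
      intro t
      induction t with
      | zero => simp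
      | succ t iht =>
        rw [mul_add, mul_one, Finset.sum_range_add, iht, Finset.sum_range_succ _ t, mul_add]
        congr 1
        rw [Finset.sum_mul]
        refine Finset.sum_congr rfl fun r _ => ?_
        rw [pow_add, pow_mul, mul_comm]
    rw [pow_succ, h]
    refine mul_dvd_mul ih ?_
    have : ∑ r ∈ Finset.range p, (q ^ p ^ k) ^ r ≡ ∑ r ∈ Finset.range p, 1 [MOD p] := by
      refine Nat.ModEq.sum fun r _ => ?_
      have := (hq.pow (p ^ k)).pow r
      simpa using this
    rw [Nat.ModEq] at this
    apply Nat.dvd_of_mod_eq_zero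
    simpa using this

theorem men_num4 (p k : ℕ) : (1 + p) ^ k ≡ 1 [MOD p] := by
  have h : 1 + p ≡ 1 [MOD p] := by simp [Nat.ModEq]
  simpa using h.pow k

/-- the relations -/
structure MenRel (p m : ℕ) {K : Type*} [Group K] (a b : K) : Prop where
  ha : a ^ p ^ (m + 3) = 1
  hb : b ^ p ^ (m + 3) = a ^ p ^ (m + 2)
  hc : b * a = a ^ (1 + p) * b

namespace MenRel

variable {p m : ℕ} {K : Type*} [Group K] {a b : K}

theorem comm1 (h : MenRel p m a b) (i : ℕ) : b * a ^ i = a ^ (i * (1 + p)) * b := by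
  induction i with
  | zero => simp
  | succ i ih => rw [pow_succ, ← mul_assoc, ih, mul_assoc, h.hc, ← mul_assoc, ← pow_add]; ring_nf

theorem comm (h : MenRel p m a b) (i j : ℕ) :
    b ^ j * a ^ i = a ^ (i * (1 + p) ^ j) * b ^ j := by
  induction j with
  | zero => simp
  | succ j ih =>
    rw [pow_succ', mul_assoc, ih, ← mul_assoc, h.comm1, mul_assoc, ← pow_succ']; ring_nf

theorem mul_form (h : MenRel p m a b) (i j k l : ℕ) :
    (a ^ i * b ^ j) * (a ^ k * b ^ l) = a ^ (i + k * (1 + p) ^ j) * b ^ (j + l) := by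
  rw [mul_assoc, ← mul_assoc (b ^ j), h.comm, pow_add, pow_add]; group

theorem pow_form (h : MenRel p m a b) (k l t : ℕ) :
    (a ^ k * b ^ l) ^ t = a ^ (k * ∑ r ∈ Finset.range t, ((1 + p) ^ l) ^ r) * b ^ (l * t) := by
  induction t with
  | zero => simp
  | succ t ih =>
    rw [pow_succ, ih, h.mul_form, Finset.sum_range_succ, ← pow_mul]; ring_nf

theorem a_pow (h : MenRel p m a b) {i j : ℕ} (hij : i ≡ j [MOD p ^ (m + 3)]) : a ^ i = a ^ j :=
  pow_eq_pow_iff_modEq.2 (hij.of_dvd (orderOf_dvd_of_pow_eq_one h.ha))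

theorem a_pow_dvd (h : MenRel p m a b) {i : ℕ} (hij : p ^ (m + 3) ∣ i) : a ^ i = 1 := by
  obtain ⟨c, rfl⟩ := hij
  rw [pow_mul, h.ha, one_pow]

theorem form (h : MenRel p m a b) [Finite K] (hp : 0 < p) (hgen : Subgroup.closure {a, b} = ⊤)
    (g : K) : ∃ i < p ^ (m + 3), ∃ j < p ^ (m + 3), g = a ^ i * b ^ j := by
  have key : ∃ i j : ℕ, g = a ^ i * b ^ j := by
    have hg : g ∈ Subgroup.closure {a, b} := by rw [hgen]; trivial
    let S : Submonoid K :=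
      { carrier := {g | ∃ i j : ℕ, g = a ^ i * b ^ j}
        one_mem' := ⟨0, 0, by simp⟩
        mul_mem' := by
          rintro _ _ ⟨i, j, rfl⟩ ⟨k, l, rfl⟩
          exact ⟨_, _, h.mul_form i j k l⟩ }
    let T : Subgroup K :=
      { S with
        inv_mem' := by
          intro x hx
          have : x⁻¹ = x ^ (orderOf x - 1) := by
            rw [inv_eq_iff_mul_eq_one, ← pow_succ', Nat.sub_add_cancel (orderOf_pos x),
              pow_orderOf_eq_one]
          rw [this]
          exact S.pow_mem hx _ }
    have : Subgroup.closure {a, b} ≤ T := by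
      rw [Subgroup.closure_le]
      rintro x (rfl | rfl)
      · exact ⟨1, 0, by simp⟩
      · exact ⟨0, 1, by simp⟩
    exact this hg
  obtain ⟨i, j, rfl⟩ := key
  have hpos : 0 < p ^ (m + 3) := pow_pos hp _
  refine ⟨(i + p ^ (m + 2) * (j / p ^ (m + 3))) % p ^ (m + 3), Nat.mod_lt _ hpos,
    j % p ^ (m + 3), Nat.mod_lt _ hpos, ?_⟩
  rw [h.a_pow (Nat.mod_modEq _ _), pow_add, pow_mul, ← h.hb, mul_assoc, ← pow_mul, ← pow_add,
    Nat.div_add_mod]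

theorem card_le (h : MenRel p m a b) [Finite K] (hp : 0 < p)
    (hgen : Subgroup.closure {a, b} = ⊤) : Nat.card K ≤ p ^ (2 * (m + 3)) := by
  have : Function.Surjective (fun x : Fin (p ^ (m + 3)) × Fin (p ^ (m + 3)) =>
      a ^ (x.1 : ℕ) * b ^ (x.2 : ℕ)) := by
    intro g
    obtain ⟨i, hi, j, hj, rfl⟩ := h.form hp hgen g
    exact ⟨(⟨i, hi⟩, ⟨j, hj⟩), rfl⟩
  have := Nat.card_le_card_of_surjective _ this
  simpa [Nat.card_prod, ← pow_add, two_mul] using this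

theorem form_inj (h : MenRel p m a b) [Finite K] (hp : 0 < p)
    (hgen : Subgroup.closure {a, b} = ⊤) (hcard : Nat.card K = p ^ (2 * (m + 3)))
    {i j k l : ℕ} (hi : i < p ^ (m + 3)) (hj : j < p ^ (m + 3)) (hk : k < p ^ (m + 3))
    (hl : l < p ^ (m + 3)) (e : a ^ i * b ^ j = a ^ k * b ^ l) : i = k ∧ j = l := by
  have hs : Function.Surjective (fun x : Fin (p ^ (m + 3)) × Fin (p ^ (m + 3)) =>
      a ^ (x.1 : ℕ) * b ^ (x.2 : ℕ)) := by
    intro g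
    obtain ⟨i, hi, j, hj, rfl⟩ := h.form hp hgen g
    exact ⟨(⟨i, hi⟩, ⟨j, hj⟩), rfl⟩
  have hb := (Nat.bijective_iff_surjective_and_card _).2
    ⟨hs, by simp [hcard, Nat.card_prod, ← pow_add, two_mul]⟩
  have := hb.1 (a₁ := (⟨i, hi⟩, ⟨j, hj⟩)) (a₂ := (⟨k, hk⟩, ⟨l, hl⟩)) e
  simpa using this

theorem lift (h : MenRel p m a b) [Finite K] (hp : 0 < p)
    (hgen : Subgroup.closure {a, b} = ⊤) (hcard : Nat.card K = p ^ (2 * (m + 3)))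
    {L : Type*} [Group L] [Finite L] {x y : L} (h' : MenRel p m x y) :
    ∃ f : K →* L, f a = x ∧ f b = y := by
  let H : Subgroup (K × L) := Subgroup.closure {(a, x), (b, y)}
  let A : H := ⟨(a, x), Subgroup.subset_closure (by simp)⟩
  let B : H := ⟨(b, y), Subgroup.subset_closure (by simp)⟩
  have hAB : MenRel p m A B := by
    constructor
    · ext <;> simp [A, h.ha, h'.ha]
    · ext <;> simp [A, B, h.hb, h'.hb]
    · ext <;> simp [A, B, h.hc, h'.hc]
  have hg : Subgroup.closure {A, B} = ⊤ := by
    have := Subgroup.closure_closure_coe_preimage (k := {(a, x), (b, y)})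
    convert this
    ext z
    simp [A, B, Subtype.ext_iff]
  have hle := hAB.card_le hp hg
  let π : H →* K := (MonoidHom.fst K L).comp H.subtype
  have hs : Function.Surjective π := by
    rw [← MonoidHom.range_eq_top, eq_top_iff, ← hgen, Subgroup.closure_le]
    rintro z (rfl | rfl)
    · exact ⟨A, rfl⟩
    · exact ⟨B, rfl⟩
  have hbij : Function.Bijective π := by
    refine (Nat.bijective_iff_surjective_and_card _).2 ⟨hs, le_antisymm (by rw [hcard]; exact hle) ?_⟩
    exact Nat.card_le_card_of_surjective _ hs
  let e := MulEquiv.ofBijective π hbij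
  have ea : e.symm a = A := by rw [MulEquiv.symm_apply_eq]; rfl
  have eb : e.symm b = B := by rw [MulEquiv.symm_apply_eq]; rfl
  refine ⟨((MonoidHom.snd K L).comp H.subtype).comp e.symm.toMonoidHom, ?_, ?_⟩
  · simp [ea, A]
  · simp [eb, B]

end MenRel

namespace MenRel

variable {p m : ℕ} {K : Type*} [Group K] {a b : K}

theorem c_comm (h : MenRel p m a b) (hp : p.Prime) (h3 : 3 ≤ p) :
    Commute a (b ^ p ^ (m + 2)) := by
  have := h.comm 1 (p ^ (m + 2))
  obtain ⟨y, hy⟩ := men_num1 p hp h3 (m + 2)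
  rw [hy, pow_one] at this
  have e : a ^ (1 * (1 + p ^ (m + 2 + 1) + p ^ (m + 2 + 2) * y)) = a := by
    conv_rhs => rw [← pow_one a]
    apply h.a_pow
    have : 1 * (1 + p ^ (m + 2 + 1) + p ^ (m + 2 + 2) * y) = 1 + p ^ (m + 3) * (1 + p * y) := by ring
    rw [this]
    simp [Nat.ModEq]
  rw [e] at this
  exact this.symm

theorem x_pow (h : MenRel p m a b) (hp : p.Prime) (h3 : 3 ≤ p) (i j t : ℕ) :
    (a ^ i * b ^ (p ^ (m + 2) * j)) ^ t = a ^ (i * t) * b ^ (p ^ (m + 2) * (j * t)) := by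
  have hc : Commute (a ^ i) (b ^ (p ^ (m + 2) * j)) := by
    rw [pow_mul]; exact (h.c_comm hp h3).pow_pow _ _
  rw [hc.mul_pow, ← pow_mul, ← pow_mul, mul_assoc]

theorem c_pow (h : MenRel p m a b) (t : ℕ) : b ^ (p ^ (m + 3) * t) = a ^ (p ^ (m + 2) * t) := by
  rw [pow_mul, h.hb, ← pow_mul]

theorem x_pow1 (h : MenRel p m a b) (hp : p.Prime) (h3 : 3 ≤ p) (i j : ℕ) :
    (a ^ i * b ^ (p ^ (m + 2) * j)) ^ p ^ (m + 2) = a ^ (i * p ^ (m + 2)) := by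
  rw [h.x_pow hp h3]
  have : p ^ (m + 2) * (j * p ^ (m + 2)) = p ^ (m + 3) * (p ^ (m + 1) * j) := by ring
  rw [this, h.c_pow, h.a_pow_dvd (i := p ^ (m + 2) * (p ^ (m + 1) * j)), mul_one]
  exact ⟨p ^ m * j, by ring⟩

theorem y_pow (h : MenRel p m a b) (k l : ℕ) :
    (a ^ k * b ^ l) ^ p ^ (m + 3) = a ^ (p ^ (m + 2) * l) := by
  rw [h.pow_form, h.a_pow_dvd, one_mul, mul_comm l, h.c_pow]
  exact (men_num3 p _ (m + 3) (men_num4 p l)).mul_left k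

theorem rel_iff (h : MenRel p m a b) (hp : p.Prime) (h3 : 3 ≤ p) (i j k l : ℕ) :
    (a ^ k * b ^ l) * (a ^ i * b ^ (p ^ (m + 2) * j)) =
      (a ^ i * b ^ (p ^ (m + 2) * j)) ^ (1 + p) * (a ^ k * b ^ l) ↔
    a ^ (i * (1 + p) ^ l) = a ^ (i * (1 + p) + p ^ (m + 2) * j) := by
  have e1 : (a ^ i * b ^ (p ^ (m + 2) * j)) ^ (1 + p) =
      a ^ (i * (1 + p) + p ^ (m + 2) * j) * b ^ (p ^ (m + 2) * j) := by
    rw [h.x_pow hp h3]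
    have : p ^ (m + 2) * (j * (1 + p)) = p ^ (m + 3) * j + p ^ (m + 2) * j := by ring
    rw [this, pow_add, h.c_pow, ← mul_assoc, ← pow_add]
  have hc : Commute (a ^ k) (b ^ (p ^ (m + 2) * j)) := by
    rw [pow_mul]; exact (h.c_comm hp h3).pow_pow _ _
  rw [e1, h.mul_form, mul_assoc, ← mul_assoc (b ^ (p ^ (m + 2) * j)), ← hc.eq, mul_assoc,
    ← pow_add, ← mul_assoc, ← pow_add, add_comm l, mul_left_inj, add_comm k, pow_add, pow_add a _ k,
    mul_left_inj]

theorem rel_of (h : MenRel p m a b) (hp : p.Prime) (h3 : 3 ≤ p) (u s k : ℕ) :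
    MenRel p m (a ^ (1 + p * u) * b ^ (p ^ (m + 2) * s)) (a ^ k * b ^ (1 + p ^ (m + 1) * s)) := by
  refine ⟨?_, ?_, ?_⟩
  · rw [pow_succ p (m + 2), pow_mul _ (p ^ (m + 2)) p, h.x_pow1 hp h3, ← pow_mul]
    exact h.a_pow_dvd ⟨1 + p * u, by ring⟩
  · rw [h.y_pow, h.x_pow1 hp h3]
    have e1 : p ^ (m + 2) * (1 + p ^ (m + 1) * s) = p ^ (m + 2) + p ^ (m + 3) * (p ^ m * s) := by
      ring
    have e2 : (1 + p * u) * p ^ (m + 2) = p ^ (m + 2) + p ^ (m + 3) * u := by ring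
    rw [e1, e2]
    apply h.a_pow
    simp [Nat.ModEq]
  · rw [h.rel_iff hp h3]
    obtain ⟨z, hz⟩ := men_num2 p hp h3 m s
    rw [pow_add, hz]
    apply h.a_pow
    have : (1 + p * u) * ((1 + p) ^ 1 * (1 + p ^ (m + 2) * s + p ^ (m + 3) * z)) =
      (1 + p * u) * (1 + p) + p ^ (m + 2) * s +
        p ^ (m + 3) * ((u * (1 + p) + 1) * s + (1 + p * u) * (1 + p) * z) := by ring
    rw [this]
    simp [Nat.ModEq]

theorem pow_mem_of_coprime {H : Subgroup K} {g : K} {N w : ℕ} (hg : g ^ N = 1) (hw : w.Coprime N)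
    (hm : g ^ w ∈ H) : g ∈ H := by
  have h1 : g ^ N ∈ H := by rw [hg]; exact H.one_mem
  have := Nat.gcd_eq_gcd_ab w N
  rw [Nat.Coprime] at hw
  rw [hw] at this
  have e : g = (g ^ w) ^ (Nat.gcdA w N) * (g ^ N) ^ (Nat.gcdB w N) := by
    rw [← zpow_natCast, ← zpow_natCast, ← zpow_mul, ← zpow_mul, ← zpow_add, ← this]; simp
  rw [e]
  exact H.mul_mem (H.zpow_mem hm _) (H.zpow_mem h1 _)

theorem gen_of (h : MenRel p m a b) (hp : p.Prime) (h3 : 3 ≤ p)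
    (hgen : Subgroup.closure {a, b} = ⊤) (u s k : ℕ) (H : Subgroup K)
    (hx : a ^ (1 + p * u) * b ^ (p ^ (m + 2) * s) ∈ H)
    (hy : a ^ k * b ^ (1 + p ^ (m + 1) * s) ∈ H) : H = ⊤ := by
  have cop : ∀ v N, (1 + p * v).Coprime (p ^ N) := by
    intro v N
    apply Nat.Coprime.pow_right
    simp
  have hap : a ^ p ∈ H := by
    apply pow_mem_of_coprime (N := p ^ (m + 3)) (w := 1 + p * (u + p ^ m * s)) _ (cop _ _)
    · have := H.pow_mem hx p
      rw [h.x_pow hp h3] at this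
      have e : p ^ (m + 2) * (s * p) = p ^ (m + 3) * s := by ring
      rw [e, h.c_pow, ← pow_add] at this
      rw [← pow_mul]
      convert this using 2
      ring
    · rw [← pow_mul]; exact h.a_pow_dvd ⟨p, by ring⟩
  have hbp : b ^ p ∈ H := by
    apply pow_mem_of_coprime (N := p ^ (m + 3)) (w := 1 + p * (p ^ m * s)) _ (cop _ _)
    · have := H.pow_mem hy p
      rw [h.pow_form] at this
      have hd := men_num3 p _ 1 (men_num4 p (1 + p ^ (m + 1) * s))
      rw [pow_one] at hd
      obtain ⟨d, hd⟩ := hd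
      rw [hd] at this
      have e : k * (p * d) = p * (k * d) := by ring
      rw [e, pow_mul a] at this
      rw [H.mul_mem_cancel_left (H.pow_mem hap _)] at this
      rw [← pow_mul]
      convert this using 2
      ring
    · rw [← pow_mul, mul_comm p, h.c_pow]; exact h.a_pow_dvd ⟨1, by ring⟩
  have ha : a ∈ H := by
    have e : p ^ (m + 2) * s = p * (p ^ (m + 1) * s) := by ring
    rw [e, pow_mul b, H.mul_mem_cancel_right (H.pow_mem hbp _), pow_add, pow_one, pow_mul,
      H.mul_mem_cancel_right (H.pow_mem hap _)] at hx
    exact hx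
  have hb : b ∈ H := by
    have e : p ^ (m + 1) * s = p * (p ^ m * s) := by ring
    rw [H.mul_mem_cancel_left (H.pow_mem ha _), e, pow_add, pow_one, pow_mul,
      H.mul_mem_cancel_right (H.pow_mem hbp _)] at hy
    exact hy
  rw [eq_top_iff, ← hgen, Subgroup.closure_le]
  rintro z (rfl | rfl)
  · exact ha
  · exact hb

theorem a_pow_inj (h : MenRel p m a b) [Finite K] (hp : 0 < p)
    (hgen : Subgroup.closure {a, b} = ⊤) (hcard : Nat.card K = p ^ (2 * (m + 3)))
    {i j : ℕ} (e : a ^ i = a ^ j) : i ≡ j [MOD p ^ (m + 3)] := by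
  have hpos : 0 < p ^ (m + 3) := pow_pos hp _
  refine (h.form_inj hp hgen hcard (i := i % p ^ (m + 3)) (k := j % p ^ (m + 3)) (j := 0) (l := 0)
    (Nat.mod_lt _ hpos) hpos (Nat.mod_lt _ hpos) hpos ?_).1
  rw [h.a_pow (Nat.mod_modEq _ _), h.a_pow (Nat.mod_modEq _ _), e]

theorem chi (h : MenRel p m a b) [Finite K] (hp : 0 < p)
    (hgen : Subgroup.closure {a, b} = ⊤) (hcard : Nat.card K = p ^ (2 * (m + 3))) :
    ∃ f : K →* Multiplicative (ZMod (p ^ (m + 3))), ∀ i j : ℕ,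
      f (a ^ i * b ^ j) = Multiplicative.ofAdd (j : ZMod (p ^ (m + 3))) := by
  haveI : NeZero (p ^ (m + 3)) := ⟨(pow_pos hp _).ne'⟩
  have h' : MenRel p m (1 : Multiplicative (ZMod (p ^ (m + 3)))) (Multiplicative.ofAdd 1) := by
    refine ⟨by simp, ?_, by simp⟩
    rw [← ofAdd_nsmul]
    rw [one_pow, ofAdd_eq_one, nsmul_eq_mul, ZMod.natCast_self, zero_mul]
  obtain ⟨f, fa, fb⟩ := h.lift hp hgen hcard h'
  refine ⟨f, fun i j => ?_⟩
  rw [map_mul, map_pow, map_pow, fa, fb, one_pow, one_mul, ← ofAdd_nsmul]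
  simp

theorem conv (h : MenRel p m a b) [Finite K] (hp : p.Prime) (h3 : 3 ≤ p)
    (hgen : Subgroup.closure {a, b} = ⊤) (hcard : Nat.card K = p ^ (2 * (m + 3)))
    (f : K ≃* K) : ∃ u < p ^ (m + 2), ∃ s < p ^ 2, ∃ k < p ^ (m + 3),
      f a = a ^ (1 + p * u) * b ^ (p ^ (m + 2) * s) ∧
      f b = a ^ k * b ^ (1 + p ^ (m + 1) * s) := by
  have h0 := hp.pos
  have hf : MenRel p m (f a) (f b) :=
    ⟨by rw [← map_pow, h.ha, map_one], by rw [← map_pow, h.hb, map_pow],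
     by rw [← map_mul, h.hc, map_mul, map_pow]⟩
  obtain ⟨i, hi, j, hj, ex⟩ := h.form h0 hgen (f a)
  obtain ⟨k, hk, l, hl, ey⟩ := h.form h0 hgen (f b)
  obtain ⟨χ, hχ⟩ := h.chi h0 hgen hcard
  -- exponent of b in f a
  have hj' : p ^ (m + 2) ∣ j := by
    have e := congrArg χ hf.hc
    rw [map_mul, map_mul, map_pow, mul_comm, mul_left_inj, pow_add (χ (f a)), pow_one] at e
    have e := left_eq_mul.1 e
    rw [ex, hχ, ← ofAdd_nsmul, ofAdd_eq_one, nsmul_eq_mul, ← Nat.cast_mul,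
      ZMod.natCast_eq_zero_iff, pow_succ', Nat.mul_dvd_mul_iff_left h0] at e
    exact e
  obtain ⟨j, rfl⟩ := hj'
  rw [ex, ey] at hf
  have r1 := h.a_pow_inj h0 hgen hcard ((h.rel_iff hp h3 _ _ _ _).1 hf.hc)
  have r2 := hf.hb
  rw [h.y_pow, h.x_pow1 hp h3, mul_comm i] at r2
  have r2 := h.a_pow_inj h0 hgen hcard r2
  rw [pow_succ p (m + 2)] at r2
  have r2 : l ≡ i [MOD p] := Nat.ModEq.mul_left_cancel' (pow_pos h0 _).ne' r2
  -- `i` is prime to `p`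
  have hpi : ¬ p ∣ i := by
    rintro ⟨d, rfl⟩
    have e : f (a ^ p ^ (m + 2)) = 1 := by
      rw [map_pow, ex, h.x_pow1 hp h3]
      exact h.a_pow_dvd ⟨d, by ring⟩
    rw [map_eq_one_iff f f.injective, ← pow_zero a] at e
    have := (Nat.modEq_zero_iff_dvd.1 (h.a_pow_inj h0 hgen hcard e))
    rw [Nat.pow_dvd_pow_iff_le_right hp.one_lt] at this
    omega
  have hcop : Nat.Coprime i p := ((Nat.Prime.coprime_iff_not_dvd hp).2 hpi).symm
  -- `l ≡ 1`
  have hord : orderOf ((1 + p : ℕ) : ZMod (p ^ (m + 2 + 1))) = p ^ (m + 2) := by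
    have := ZMod.orderOf_one_add_prime hp (by omega) (m + 2)
    push_cast
    exact this
  have hord1 : orderOf ((1 + p : ℕ) : ZMod (p ^ (1 + 1))) = p ^ 1 := by
    have := ZMod.orderOf_one_add_prime hp (by omega) 1
    push_cast
    exact this
  have hcopp : ∀ N, Nat.Coprime (1 + p) (p ^ N) := fun N => by
    apply Nat.Coprime.pow_right; simp
  have l1 : l ≡ 1 [MOD p] := by
    have q : i * (1 + p) ^ l ≡ i * (1 + p) ^ 1 [MOD p ^ 2] := by
      refine (r1.of_dvd (pow_dvd_pow p (by omega))).trans ?_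
      have : p ^ (m + 2) * j = p ^ 2 * (p ^ m * j) := by ring
      rw [this, pow_one]
      simp [Nat.ModEq]
    have q := Nat.ModEq.cancel_left_of_coprime (by
      rw [Nat.gcd_comm]; exact Nat.Coprime.pow_right 2 hcop) q
    rw [← ZMod.natCast_eq_natCast_iff, Nat.cast_pow, Nat.cast_pow] at q
    have hu : IsUnit ((1 + p : ℕ) : ZMod (p ^ 2)) := (ZMod.isUnit_iff_coprime _ _).2 (hcopp 2)
    obtain ⟨v, hv⟩ := hu
    rw [← hv] at q
    rw [← hv, orderOf_units, pow_one] at hord1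
    rw [← hord1]
    exact pow_eq_pow_iff_modEq.1 (Units.ext (by push_cast; exact q))
  have i1 : i ≡ 1 [MOD p] := r2.symm.trans l1
  have lpos : 1 ≤ l := by
    rcases Nat.eq_zero_or_pos l with rfl | hh
    · have := (Nat.modEq_iff_dvd' (Nat.zero_le 1)).1 l1
      have := Nat.le_of_dvd one_pos this
      omega
    · exact hh
  obtain ⟨l, rfl⟩ := Nat.exists_eq_add_of_le lpos
  -- compare powers of 1+p
  have r3 : l ≡ p ^ (m + 1) * j [MOD p ^ (m + 2)] := by
    have q : i * (1 + p) * (1 + p) ^ l ≡ i * (1 + p) * (1 + p) ^ (p ^ (m + 1) * j)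
        [MOD p ^ (m + 3)] := by
      have e1 : i * (1 + p) * (1 + p) ^ l = i * (1 + p) ^ (1 + l) := by ring
      rw [e1]
      refine r1.trans ?_
      obtain ⟨z, hz⟩ := men_num2 p hp h3 m j
      rw [hz]
      have e2 : i * (1 + p) * (1 + p ^ (m + 2) * j + p ^ (m + 3) * z) =
        (i * (1 + p) + p ^ (m + 2) * (i * j)) + p ^ (m + 3) * (i * j + i * (1 + p) * z) := by ring
      rw [e2]
      have e3 : p ^ (m + 2) * j ≡ p ^ (m + 2) * (i * j) [MOD p ^ (m + 3)] := by
        rw [pow_succ p (m + 2)]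
        apply Nat.ModEq.mul_left'
        simpa using (i1.mul_right j).symm
      refine (e3.add_left _).trans ?_
      simp [Nat.ModEq]
    have q := Nat.ModEq.cancel_left_of_coprime (by
      rw [Nat.gcd_comm]; exact Nat.Coprime.mul_left (Nat.Coprime.pow_right _ hcop) (hcopp _)) q
    rw [← ZMod.natCast_eq_natCast_iff, Nat.cast_pow, Nat.cast_pow] at q
    have hu : IsUnit ((1 + p : ℕ) : ZMod (p ^ (m + 3))) :=
      (ZMod.isUnit_iff_coprime _ _).2 (hcopp _)
    obtain ⟨v, hv⟩ := hu
    rw [← hv] at q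
    rw [← hv, orderOf_units] at hord
    rw [← hord]
    exact pow_eq_pow_iff_modEq.1 (Units.ext (by push_cast; exact q))
  have hs : p ^ (m + 1) ∣ l := by
    have : l ≡ 0 [MOD p ^ (m + 1)] :=
      (r3.of_dvd (pow_dvd_pow p (by omega))).trans (by simp [Nat.ModEq])
    exact (Nat.modEq_zero_iff_dvd).1 this
  obtain ⟨s, rfl⟩ := hs
  rw [pow_succ p (m + 1)] at r3
  have r4 : s ≡ j [MOD p] := Nat.ModEq.mul_left_cancel' (pow_pos h0 _).ne' r3
  have hsl : s < p ^ 2 := by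
    have : p ^ (m + 1) * s < p ^ (m + 1) * p ^ 2 := by
      rw [← pow_add]; exact lt_of_le_of_lt (by omega) hl
    exact lt_of_mul_lt_mul_left this (Nat.zero_le _)
  -- adjust
  let i' := (i + p ^ (m + 2) * (j / p + (p - 1) * (s / p))) % p ^ (m + 3)
  have hi' : i' ≡ 1 [MOD p] := by
    refine ((Nat.mod_modEq _ _).of_dvd (dvd_pow_self p (by omega))).trans ?_
    have : p ^ (m + 2) * (j / p + (p - 1) * (s / p)) =
      p * (p ^ (m + 1) * (j / p + (p - 1) * (s / p))) := by ring
    rw [this]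
    refine Nat.ModEq.trans ?_ i1
    simp [Nat.ModEq]
  have hi'pos : 1 ≤ i' := by
    rcases Nat.eq_zero_or_pos i' with hh | hh
    · rw [hh] at hi'
      have := (Nat.modEq_iff_dvd' (Nat.zero_le 1)).1 hi'
      have := Nat.le_of_dvd one_pos this
      omega
    · exact hh
  obtain ⟨u, hu⟩ := (Nat.modEq_iff_dvd' hi'pos).1 hi'.symm
  have hu' : i' = 1 + p * u := by omega
  have hi'lt : i' < p ^ (m + 3) := Nat.mod_lt _ (pow_pos h0 _)
  refine ⟨u, ?_, s, hsl, k, hk, ?_, ey⟩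
  · have : p * u < p * p ^ (m + 2) := by
      rw [← pow_succ']; exact lt_of_le_of_lt (by omega) hi'lt
    exact lt_of_mul_lt_mul_left this (Nat.zero_le _)
  · rw [ex, ← hu', h.a_pow (Nat.mod_modEq _ _)]
    have cc : ∀ t, b ^ (p ^ (m + 2) * t) = a ^ (p ^ (m + 2) * (t / p)) * b ^ (p ^ (m + 2) * (t % p)) := by
      intro t
      rw [← h.c_pow, ← pow_add]
      congr 1
      conv_lhs => rw [← Nat.div_add_mod t p]
      ring
    rw [cc j, cc s, r4, ← mul_assoc, ← mul_assoc, ← pow_add, ← pow_add, mul_left_inj]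
    apply h.a_pow
    obtain ⟨q, rfl⟩ := Nat.exists_eq_add_of_le hp.one_lt.le
    have : i + (1 + q) ^ (m + 2) * (j / (1 + q) + (1 + q - 1) * (s / (1 + q))) +
        (1 + q) ^ (m + 2) * (s / (1 + q)) = i + (1 + q) ^ (m + 2) * (j / (1 + q)) +
        (1 + q) ^ (m + 3) * (s / (1 + q)) := by
      rw [Nat.add_sub_cancel_left]; ring
    rw [this]
    simp [Nat.ModEq]

theorem param_inj (h : MenRel p m a b) [Finite K] (hp : p.Prime)
    (hgen : Subgroup.closure {a, b} = ⊤) (hcard : Nat.card K = p ^ (2 * (m + 3)))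
    {u s k u' s' k' : ℕ} (hu : u < p ^ (m + 2)) (hu' : u' < p ^ (m + 2))
    (hs : s < p ^ 2) (hs' : s' < p ^ 2) (hk : k < p ^ (m + 3)) (hk' : k' < p ^ (m + 3))
    (e1 : a ^ (1 + p * u) * b ^ (p ^ (m + 2) * s) = a ^ (1 + p * u') * b ^ (p ^ (m + 2) * s'))
    (e2 : a ^ k * b ^ (1 + p ^ (m + 1) * s) = a ^ k' * b ^ (1 + p ^ (m + 1) * s')) :
    u = u' ∧ s = s' ∧ k = k' := by
  have h0 := hp.pos
  have bd : ∀ N t, t < p ^ N → 1 + p * t < p ^ (N + 1) := by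
    intro N t ht
    have : p * (t + 1) ≤ p * p ^ N := Nat.mul_le_mul_left _ ht
    rw [pow_succ']
    have := hp.two_le
    nlinarith
  have bd2 : ∀ t, t < p ^ 2 → 1 + p ^ (m + 1) * t < p ^ (m + 3) := by
    intro t ht
    have : p ^ (m + 1) * (t + 1) ≤ p ^ (m + 1) * p ^ 2 := Nat.mul_le_mul_left _ ht
    rw [← pow_add] at this
    have h2 : 2 ≤ p ^ (m + 1) := le_trans hp.two_le (Nat.le_self_pow (by omega) p)
    have e : m + 1 + 2 = m + 3 := by omega
    rw [e] at this
    nlinarith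
  obtain ⟨hk, hl⟩ := h.form_inj h0 hgen hcard hk (bd2 s hs) hk' (bd2 s' hs') e2
  have hss : s = s' := by
    have : p ^ (m + 1) * s = p ^ (m + 1) * s' := by omega
    exact Nat.eq_of_mul_eq_mul_left (pow_pos h0 _) this
  subst hss
  have e1 := mul_right_cancel e1
  have := h.form_inj h0 hgen hcard (j := 0) (l := 0) (bd _ _ hu) (pow_pos h0 _) (bd _ _ hu')
    (pow_pos h0 _) (by rw [e1])
  have : p * u = p * u' := by omega
  exact ⟨Nat.eq_of_mul_eq_mul_left h0 this, rfl, hk⟩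

theorem ext_aut (hgen : Subgroup.closure {a, b} = ⊤) {f g : K ≃* K} (e1 : f a = g a)
    (e2 : f b = g b) : f = g := by
  have : f.toMonoidHom = g.toMonoidHom := by
    apply MonoidHom.eq_of_eqOn_dense hgen
    rintro z (rfl | rfl)
    · exact e1
    · exact e2
  ext z
  exact DFunLike.congr_fun this z

theorem card_aut (h : MenRel p m a b) [Finite K] (hp : p.Prime) (h3 : 3 ≤ p)
    (hgen : Subgroup.closure {a, b} = ⊤) (hcard : Nat.card K = p ^ (2 * (m + 3))) :
    Nat.card (K ≃* K) = p ^ (m + 2) * (p ^ 2 * p ^ (m + 3)) := by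
  have ex : ∀ t : Fin (p ^ (m + 2)) × Fin (p ^ 2) × Fin (p ^ (m + 3)), ∃ f : K ≃* K,
      f a = a ^ (1 + p * (t.1 : ℕ)) * b ^ (p ^ (m + 2) * (t.2.1 : ℕ)) ∧
      f b = a ^ (t.2.2 : ℕ) * b ^ (1 + p ^ (m + 1) * (t.2.1 : ℕ)) := by
    rintro ⟨u, s, k⟩
    obtain ⟨f, fa, fb⟩ := h.lift hp.pos hgen hcard (h.rel_of hp h3 u s k)
    have hs : Function.Surjective f := by
      rw [← MonoidHom.range_eq_top]
      exact h.gen_of hp h3 hgen u s k f.range ⟨a, fa⟩ ⟨b, fb⟩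
    exact ⟨MulEquiv.ofBijective f (Finite.surjective_iff_bijective.1 hs), fa, fb⟩
  choose F hFa hFb using ex
  have hF : Function.Bijective F := by
    constructor
    · rintro ⟨u, s, k⟩ ⟨u', s', k'⟩ e
      have e1 := hFa (u, s, k)
      have e2 := hFb (u, s, k)
      rw [e, hFa] at e1
      rw [e, hFb] at e2
      obtain ⟨q1, q2, q3⟩ := h.param_inj hp hgen hcard u'.2 u.2 s'.2 s.2 k'.2 k.2 e1 e2
      simp only [Prod.mk.injEq]
      exact ⟨Fin.ext q1.symm, Fin.ext q2.symm, Fin.ext q3.symm⟩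
    · intro f
      obtain ⟨u, hu, s, hs, k, hk, fa, fb⟩ := h.conv hp h3 hgen hcard f
      refine ⟨(⟨u, hu⟩, ⟨s, hs⟩, ⟨k, hk⟩), ext_aut hgen ?_ ?_⟩
      · rw [hFa, fa]
      · rw [hFb, fb]
  rw [← Nat.card_eq_of_bijective F hF]
  simp [Nat.card_prod]

end MenRel

/-- Menegazzo: for an odd prime `p` and `n ≥ 3`, the group
`G = ⟨a, b : a^(p^n) = 1, b^(p^n) = a^(p^(n-1)), a^b = a^(1+p)⟩`, of order `p ^ (2n)`,
has automorphism group of order `p · |G|`. -/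
theorem card_aut_menegazzo (p : ℕ) [Fact p.Prime] (hp : Odd p) (n : ℕ) (hn : 3 ≤ n)
    (G : Type*) [Group G] [Finite G] (a b : G)
    (ha : a ^ p ^ n = 1) (hb : b ^ p ^ n = a ^ p ^ (n - 1))
    (hconj : b * a * b⁻¹ = a ^ (1 + p))
    (hgen : Subgroup.closure {a, b} = ⊤) (hcard : Nat.card G = p ^ (2 * n)) :
    Nat.card (MulAut G) = p * Nat.card G := by
  have hpr : p.Prime := Fact.out
  have h3 : 3 ≤ p := by
    have := hpr.two_le
    rcases hp with ⟨t, rfl⟩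
    omega
  obtain ⟨m, rfl⟩ := Nat.exists_eq_add_of_le' hn
  have h : MenRel p m a b := ⟨ha, hb, by rw [← hconj]; group⟩
  have := h.card_aut hpr h3 hgen hcard
  rw [hcard]
  change Nat.card (G ≃* G) = _
  rw [this]
  ring
end
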